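/- arXiv:2302.11764 — 4 statements merged into one kernel-verified Lean document; each statement's English description precedes it below -/
import Mathlib

section
/- Let P ⊆ ℝ² be a polygon (a full-dimensional compact convex polytope in ℝ²). Then the intersection body IP is a convex set if and only if P = −P (i.e., P is centrally symmetric with center the origin). -/
open MeasureTheory
open scoped RealInnerProductSpace

noncomputable section

/-- The hyperplane through the origin orthogonal to `x`. -/
def perp {d : ℕ} (x : EuclideanSpace ℝ (Fin d)) : Set (EuclideanSpace ℝ (Fin d)) :=
  {y | ⟪x, y⟫ = 0}

/-- Radial function of the intersection body: `x ↦ vol_s(P ∩ x^⊥) / ‖x‖`,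
where `vol_s` is the `s`-dimensional Hausdorff measure. -/
def radialFn {d : ℕ} (s : ℝ) (P : Set (EuclideanSpace ℝ (Fin d)))
    (x : EuclideanSpace ℝ (Fin d)) : ℝ :=
  (μH[s] (P ∩ perp x)).toReal / ‖x‖

/-- The intersection body `IP = {0} ∪ {x ≠ 0 : ρ_IP(x) ≥ 1}`. -/
def ibody {d : ℕ} (s : ℝ) (P : Set (EuclideanSpace ℝ (Fin d))) :
    Set (EuclideanSpace ℝ (Fin d)) :=
  {0} ∪ {x | x ≠ 0 ∧ 1 ≤ radialFn s P x}

/-- A polytope: the convex hull of finitely many points. -/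
def IsPolytope {d : ℕ} (P : Set (EuclideanSpace ℝ (Fin d))) : Prop :=
  ∃ S : Finset (EuclideanSpace ℝ (Fin d)), P = convexHull ℝ (S : Set (EuclideanSpace ℝ (Fin d)))

/-- `conv(a,b)` is an edge of `P`: a one-dimensional face (i.e. an extreme convex subset). -/
def IsEdgeOf {d : ℕ} (P : Set (EuclideanSpace ℝ (Fin d))) (a b : EuclideanSpace ℝ (Fin d)) :
    Prop :=
  a ≠ b ∧ IsExtreme ℝ P (segment ℝ a b)

open Set Filter Topology

variable {E : Type*} [NormedAddCommGroup E] [NormedSpace ℝ E]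

/-- The length of `{t : ℝ | t • u ∈ P}`, the chord of `P` along `u` in units of `u`. -/
def chord (P : Set E) (u : E) : ℝ := (volume {t : ℝ | t • u ∈ P}).toReal

/-- The star body whose radial function is `chord P`. -/
def chordBody (P : Set E) : Set E := {u | u = 0 ∨ 1 ≤ chord P u}

theorem chord_nonneg (P : Set E) (u : E) : 0 ≤ chord P u := ENNReal.toReal_nonneg

theorem chord_smul (P : Set E) (u : E) {c : ℝ} (hc : c ≠ 0) :
    chord P (c • u) = |c|⁻¹ * chord P u := by
  have : {t : ℝ | t • c • u ∈ P} = (· * c) ⁻¹' {t : ℝ | t • u ∈ P} := by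
    ext t; simp [smul_smul]
  rw [chord, this, Real.volume_preimage_mul_right hc, ENNReal.toReal_mul, chord, abs_inv,
    ENNReal.toReal_ofReal (by positivity)]

theorem chord_neg (P : Set E) (u : E) : chord P (-u) = chord P u := by
  have := chord_smul P u (c := -1) (by norm_num)
  simpa using this

theorem isCompact_chord {P : Set E} (hP : IsCompact P) {u : E} (hu : u ≠ 0) :
    IsCompact {t : ℝ | t • u ∈ P} :=
  (isClosedEmbedding_smul_left (𝕜 := ℝ) hu).isCompact_preimage hP

theorem chord_pos_of_mem_interior {P : Set E} (hP : IsCompact P) {u : E} (hu : u ≠ 0)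
    (hi : u ∈ interior P) : 0 < chord P u := by
  refine ENNReal.toReal_pos ?_ (isCompact_chord hP hu).measure_lt_top.ne
  have ho : IsOpen {t : ℝ | t • u ∈ interior P} :=
    isOpen_interior.preimage (by fun_prop : Continuous fun t : ℝ => t • u)
  have := ho.measure_pos volume ⟨1, by simpa using hi⟩
  exact (this.trans_le (measure_mono fun t ht => mem_ofPred_eq.symm ▸ interior_subset (s := P) ht)).ne'

theorem inv_chord_add_le {P : Set E} (hK : Convex ℝ (chordBody P)) {u v : E}
    (hu : 0 < chord P u) (hv : 0 < chord P v) (huv : u + v ≠ 0) :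
    0 < chord P (u + v) ∧ (chord P (u + v))⁻¹ ≤ (chord P u)⁻¹ + (chord P v)⁻¹ := by
  have mem : ∀ w, 0 < chord P w → chord P w • w ∈ chordBody P := fun w hw => by
    right
    rw [chord_smul P w hw.ne', abs_of_pos hw, inv_mul_cancel₀ hw.ne']
  set s := (chord P u)⁻¹ + (chord P v)⁻¹ with hs
  have hs0 : 0 < s := by positivity
  have h := hK (mem u hu) (mem v hv) (a := (chord P u)⁻¹ / s) (b := (chord P v)⁻¹ / s)
    (by positivity) (by positivity) (by rw [← add_div, ← hs, div_self hs0.ne'])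
  have e : ((chord P u)⁻¹ / s) • chord P u • u + ((chord P v)⁻¹ / s) • chord P v • v
      = s⁻¹ • (u + v) := by
    rw [smul_smul, smul_smul, smul_add]
    congr 2 <;> field_simp
  rw [e] at h
  rcases h with h | h
  · exact absurd h (smul_ne_zero (inv_ne_zero hs0.ne') huv)
  · rw [chord_smul P _ (inv_ne_zero hs0.ne'), abs_of_pos (inv_pos.2 hs0), inv_inv] at h
    have hp : 0 < chord P (u + v) := by
      by_contra hn
      nlinarith [chord_nonneg P (u + v)]
    exact ⟨hp, by rw [inv_le_iff_one_le_mul₀ hp]; exact h⟩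

theorem exists_chord_le_of_nonneg {P : Set E} (hP : IsCompact P) {u : E}
    (hpos : 0 < chord P u) (hu : u ≠ 0) (hs : ∀ t : ℝ, t • u ∈ P → 0 ≤ t) :
    ∃ t, chord P u ≤ t ∧ t • u ∈ P := by
  have hne : {t : ℝ | t • u ∈ P}.Nonempty := by
    rw [nonempty_iff_ne_empty]
    intro h
    simp [chord, h] at hpos
  obtain ⟨m, hm, hmax⟩ := (isCompact_chord hP hu).exists_isGreatest hne
  refine ⟨m, ?_, hm⟩
  have hsub : {t : ℝ | t • u ∈ P} ⊆ Icc 0 m := fun t ht => ⟨hs t ht, hmax ht⟩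
  have := ENNReal.toReal_mono (by simp) (measure_mono (μ := volume) hsub)
  rwa [Real.volume_Icc, ENNReal.toReal_ofReal (by linarith [hs m hm]), sub_zero] at this

/-- If `φ` is nonnegative on `P`, positive at an interior point and vanishes at `w`, then convexity
of the chord body forces a whole chord length to lie on the `w`-side of the origin. -/
theorem exists_chord_le_of_supporting {P : Set E} (hP : IsCompact P)
    (hK : Convex ℝ (chordBody P)) {φ : E →L[ℝ] ℝ} (hφ : ∀ x ∈ P, 0 ≤ φ x) {p : E}
    (hp : 0 < chord P p) (hφp : 0 < φ p) {w : E} (hw₀ : w ≠ 0) (hw : φ w = 0)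
    (hwpos : 0 < chord P w) :
    ∃ t, chord P w ≤ t ∧ t • w ∈ P := by
  have key : ∀ n : ℕ, ∃ t : ℝ, ((chord P w)⁻¹ + (1 / ((n : ℝ) + 1)) * (chord P p)⁻¹)⁻¹ ≤ t ∧
      t • (w + (1 / ((n : ℝ) + 1)) • p) ∈ P := by
    intro n
    set ε : ℝ := 1 / ((n : ℝ) + 1)
    have hε : 0 < ε := by positivity
    have hφu : 0 < φ (w + ε • p) := by simp [hw]; positivity
    have hne : w + ε • p ≠ 0 := by rintro h; simp [h] at hφu
    have hεp : chord P (ε • p) = ε⁻¹ * chord P p := by rw [chord_smul P p hε.ne', abs_of_pos hε]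
    obtain ⟨h1, h2⟩ := inv_chord_add_le hK hwpos (by rw [hεp]; positivity) hne
    obtain ⟨t, ht, htP⟩ := exists_chord_le_of_nonneg hP h1 hne fun t ht => by
      have := hφ _ ht
      rw [map_smul, smul_eq_mul] at this
      exact nonneg_of_mul_nonneg_left this hφu
    refine ⟨t, le_trans ?_ ht, htP⟩
    rw [inv_le_comm₀ (by positivity) h1]
    simpa [hεp, mul_comm] using h2
  choose t ht htP using key
  have hlim : Tendsto (fun n : ℕ => 1 / ((n : ℝ) + 1)) atTop (𝓝 0) :=
    tendsto_one_div_add_atTop_nhds_zero_nat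
  obtain ⟨x, hx, k, hk, hkx⟩ := hP.tendsto_subseq htP
  have hlimk := hlim.comp hk.tendsto_atTop
  have hu : Tendsto (fun n => w + (1 / ((k n : ℝ) + 1)) • p) atTop (𝓝 w) := by
    simpa using tendsto_const_nhds.add (hlimk.smul_const p)
  have hb : Tendsto (fun n => ((chord P w)⁻¹ + (1 / ((k n : ℝ) + 1)) * (chord P p)⁻¹)⁻¹) atTop
      (𝓝 (chord P w)) := by
    have := (tendsto_const_nhds (x := (chord P w)⁻¹)).add (hlimk.mul_const (chord P p)⁻¹)
    have := this.inv₀ (by simp [hwpos.ne'])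
    simpa using this
  have htpos : ∀ n, 0 < t n := fun n => lt_of_lt_of_le (by positivity) (ht n)
  have htlim : Tendsto (fun n => t (k n)) atTop (𝓝 (‖x‖ / ‖w‖)) := by
    refine (hkx.norm.div hu.norm (norm_ne_zero_iff.2 hw₀)).congr' ?_
    filter_upwards [hu.norm.eventually_ne (norm_ne_zero_iff.2 hw₀)] with n hn
    simp only [Function.comp_apply, Pi.div_apply]
    rw [norm_smul, mul_div_cancel_right₀ _ hn, Real.norm_of_nonneg (htpos _).le]
  refine ⟨‖x‖ / ‖w‖, le_of_tendsto_of_tendsto' hb htlim fun n => ht (k n), ?_⟩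
  rwa [tendsto_nhds_unique (htlim.smul hu) hkx]

theorem chord_nonpos_of_le_of_le {P : Set E} (hP : IsCompact P) (hc : Convex ℝ P) {w : E}
    (hw : w ≠ 0) {a b : ℝ} (ha : chord P w ≤ a) (hb : chord P w ≤ b) (haP : a • w ∈ P)
    (hbP : b • -w ∈ P) : chord P w ≤ 0 := by
  have hsub : Icc (-b) a ⊆ {t : ℝ | t • w ∈ P} := by
    have hconv : Convex ℝ {t : ℝ | t • w ∈ P} :=
      hc.linear_preimage (LinearMap.toSpanSingleton ℝ E w)
    exact hconv.ordConnected.out (by simpa using hbP) haP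
  have h := ENNReal.toReal_mono (isCompact_chord hP hw).measure_lt_top.ne
    (measure_mono (μ := volume) hsub)
  have h0 := chord_nonneg P w
  rw [Real.volume_Icc, ENNReal.toReal_ofReal (by linarith)] at h
  change _ ≤ chord P w at h
  linarith

/-- Convexity of the chord body forces the origin into the interior. -/
theorem zero_mem_interior_of_convex_chordBody {P : Set E} (hP : IsCompact P) (hc : Convex ℝ P)
    (hne : (interior P).Nonempty) (hdim : ∀ φ : E →L[ℝ] ℝ, ∃ w ≠ 0, φ w = 0)
    (hK : Convex ℝ (chordBody P)) : (0 : E) ∈ interior P := by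
  by_contra h0
  obtain ⟨φ, hφ⟩ := geometric_hahn_banach_point_open hc.interior isOpen_interior h0
  rw [map_zero] at hφ
  have hφP : ∀ x ∈ P, 0 ≤ φ x := by
    intro x hx
    have hx' : x ∈ closure (interior P) := by
      rw [hc.closure_interior_eq_closure_of_nonempty_interior hne]
      exact subset_closure hx
    exact closure_minimal (fun y hy => (hφ y hy).le)
      (isClosed_Ici.preimage φ.continuous) hx'
  obtain ⟨p, hp⟩ := hne
  obtain ⟨w, hw0, hw⟩ := hdim φ
  have ne0 : ∀ y ∈ interior P, y ≠ 0 := fun y hy h => h0 (h ▸ hy)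
  have hpp := chord_pos_of_mem_interior hP (ne0 p hp) hp
  obtain ⟨s, hs, hs0⟩ : ∃ s : ℝ, p + s • w ∈ interior P ∧ 0 < s := by
    have hcont : Tendsto (fun s : ℝ => p + s • w) (𝓝[>] 0) (𝓝 p) := by
      have : Continuous fun s : ℝ => p + s • w := by fun_prop
      simpa using (this.tendsto 0).mono_left nhdsWithin_le_nhds
    exact ((hcont.eventually (isOpen_interior.mem_nhds hp)).and self_mem_nhdsWithin).exists
  have hsw : 0 < chord P (s • w) := by
    have := (inv_chord_add_le hK (chord_pos_of_mem_interior hP (ne0 _ hs) hs)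
      (by rwa [chord_neg]) (v := -p) (by simpa using ⟨hs0.ne', hw0⟩)).1
    simpa using this
  have hsw0 : s • w ≠ 0 := smul_ne_zero hs0.ne' hw0
  obtain ⟨a, ha, haP⟩ := exists_chord_le_of_supporting hP hK hφP hpp (hφ p hp) hsw0
    (by simp [hw]) hsw
  obtain ⟨b, hb, hbP⟩ := exists_chord_le_of_supporting hP hK hφP hpp (hφ p hp)
    (neg_ne_zero.2 hsw0) (by simp [hw]) (by rwa [chord_neg])
  rw [chord_neg] at hb
  exact (chord_nonpos_of_le_of_le hP hc hsw0 ha hb haP hbP).not_gt hsw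

theorem gauge_pos_of_isCompact {P : Set E} (hP : IsCompact P) (h0 : P ∈ 𝓝 (0 : E)) {u : E}
    (hu : u ≠ 0) : 0 < gauge P u :=
  (gauge_pos (absorbent_nhds_zero h0)
    (NormedSpace.isVonNBounded_of_isBounded ℝ hP.isBounded)).2 hu

theorem mem_iff_gauge_le_one {P : Set E} (hP : IsCompact P) (hc : Convex ℝ P)
    (h0 : P ∈ 𝓝 (0 : E)) {u : E} : u ∈ P ↔ gauge P u ≤ 1 := by
  rw [gauge_le_one_iff_mem_closure hc h0, hP.isClosed.closure_eq]

theorem chord_eq_inv_gauge_add {P : Set E} (hP : IsCompact P) (hc : Convex ℝ P)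
    (h0 : P ∈ 𝓝 (0 : E)) {u : E} (hu : u ≠ 0) :
    chord P u = (gauge P u)⁻¹ + (gauge P (-u))⁻¹ := by
  have hg := gauge_pos_of_isCompact hP h0 hu
  have hg' := gauge_pos_of_isCompact hP h0 (neg_ne_zero.2 hu)
  have : {t : ℝ | t • u ∈ P} = Icc (-(gauge P (-u))⁻¹) (gauge P u)⁻¹ := by
    ext t
    rw [mem_ofPred_eq, mem_iff_gauge_le_one hP hc h0, mem_Icc]
    rcases le_total 0 t with ht | ht
    · rw [gauge_smul_of_nonneg ht, smul_eq_mul, ← le_div_iff₀ hg, one_div]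
      exact ⟨fun h => ⟨by linarith [inv_pos.2 hg'], h⟩, fun h => h.2⟩
    · rw [← neg_smul_neg, gauge_smul_of_nonneg (neg_nonneg.2 ht), smul_eq_mul,
        ← le_div_iff₀ hg', one_div]
      exact ⟨fun h => ⟨by linarith, by linarith [inv_pos.2 hg]⟩, fun h => by linarith [h.1]⟩
  have h1 := inv_pos.2 hg
  have h2 := inv_pos.2 hg'
  rw [chord, this, Real.volume_Icc, ENNReal.toReal_ofReal (by linarith), sub_neg_eq_add]

theorem convex_chordBody_of_eq_neg {P : Set E} (hP : IsCompact P) (hc : Convex ℝ P)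
    (h0 : P ∈ 𝓝 (0 : E)) (hsymm : P = -P) : Convex ℝ (chordBody P) := by
  have habs : Absorbent ℝ P := absorbent_nhds_zero h0
  have h : chordBody P = {u | gauge P u ≤ 2} := by
    ext u
    rcases eq_or_ne u 0 with rfl | hu
    · simp [chordBody]
    · have hg := gauge_pos_of_isCompact hP h0 hu
      have hn : gauge P (-u) = gauge P u :=
        gauge_neg (fun x hx => by rw [hsymm]; simpa using hx) u
      simp only [chordBody, mem_ofPred_eq, hu, false_or, chord_eq_inv_gauge_add hP hc h0 hu, hn]
      rw [← two_mul, ← div_eq_mul_inv, le_div_iff₀ hg, one_mul]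
  rw [h]
  exact hc.setOfPred_gauge_le (mem_of_mem_nhds h0) habs 2

theorem exists_linearMap_le_gauge {P : Set E} (hc : Convex ℝ P) (h0 : P ∈ 𝓝 (0 : E)) (u : E) :
    ∃ y : E →ₗ[ℝ] ℝ, y u = gauge P u ∧ ∀ x, y x ≤ gauge P x := by
  rcases eq_or_ne u 0 with rfl | hu
  · exact ⟨0, by simp, fun x => by simpa using gauge_nonneg x⟩
  obtain ⟨y, hy, hle⟩ := exists_extension_of_le_sublinear
    (LinearPMap.mkSpanSingleton (σ := RingHom.id ℝ) u (gauge P u) hu) (gauge P)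
    (fun c hcpos x => by rw [gauge_smul_of_nonneg hcpos.le, smul_eq_mul])
    (gauge_add_le hc (absorbent_nhds_zero h0)) (by
      rintro ⟨x, hx⟩
      obtain ⟨c, rfl⟩ := Submodule.mem_span_singleton.1 hx
      rw [LinearPMap.mkSpanSingleton'_apply]
      simp only [RingHom.id_apply, smul_eq_mul]
      rcases le_total 0 c with h | h
      · rw [gauge_smul_of_nonneg h, smul_eq_mul]
      · exact (mul_nonpos_of_nonpos_of_nonneg h (gauge_nonneg _)).trans (gauge_nonneg _))
  refine ⟨y, ?_, hle⟩
  rw [← LinearPMap.mkSpanSingleton_apply (σ := RingHom.id ℝ) ℝ ℝ hu (gauge P u), ← hy]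

theorem exists_conic_combination_gauge (S : Finset E)
    (hcl : IsCompact (convexHull ℝ (S : Set E)))
    (h0 : convexHull ℝ (S : Set E) ∈ 𝓝 (0 : E)) (u : E) :
    ∃ c : E → ℝ, (∀ s ∈ S, 0 ≤ c s) ∧ ∑ s ∈ S, c s = gauge (convexHull ℝ (S : Set E)) u ∧
      ∑ s ∈ S, c s • s = u := by
  rcases eq_or_ne u 0 with rfl | hu
  · exact ⟨0, by simp, by simp, by simp⟩
  set P := convexHull ℝ (S : Set E)
  have hg := gauge_pos_of_isCompact hcl h0 hu
  have hmem : (gauge P u)⁻¹ • u ∈ P := by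
    rw [mem_iff_gauge_le_one hcl (convex_convexHull ℝ _) h0, gauge_smul_of_nonneg (by positivity),
      smul_eq_mul, inv_mul_cancel₀ hg.ne']
  obtain ⟨c, hc0, hc1, hcu⟩ := Finset.mem_convexHull'.1 hmem
  refine ⟨fun s => gauge P u * c s, fun s hs => mul_nonneg hg.le (hc0 s hs), ?_, ?_⟩
  · rw [← Finset.mul_sum, hc1, mul_one]
  · simp_rw [mul_smul]
    rw [← Finset.smul_sum, hcu, smul_inv_smul₀ hg.ne']

/-- The gauge of a polytope is linear on a short segment `[p, p + ε v]` issuing from any point. -/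
theorem exists_linearMap_eventually_eq_gauge (S : Finset E)
    (h0 : convexHull ℝ (S : Set E) ∈ 𝓝 (0 : E)) (p v : E) :
    ∃ y : E →ₗ[ℝ] ℝ, ∃ ε > 0, ∀ δ ∈ Icc (0 : ℝ) ε,
      gauge (convexHull ℝ (S : Set E)) (p + δ • v) = y (p + δ • v) := by
  classical
  have hP : IsCompact (convexHull ℝ (S : Set E)) := S.finite_toSet.isCompact_convexHull ℝ
  have hc := convex_convexHull ℝ (S : Set E)
  choose c hc0 hcg hcu using exists_conic_combination_gauge S hP h0
  choose y hyu hyle using exists_linearMap_le_gauge hc h0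
  set P := convexHull ℝ (S : Set E)
  have habs : Absorbent ℝ P := absorbent_nhds_zero h0
  let T : E → Finset S := fun u => Finset.univ.filter fun s => c u s ≠ 0
  have hys : ∀ u, ∀ s ∈ S, y u s ≤ 1 := fun u s hs =>
    (hyle u s).trans (gauge_le_one_of_mem (subset_convexHull ℝ _ hs))
  have htight : ∀ u, ∀ s ∈ S, c u s ≠ 0 → y u s = 1 := by
    intro u s hs hcs
    have hsum : ∑ s ∈ S, c u s * (1 - y u s) = 0 := by
      simp_rw [mul_sub, mul_one]
      rw [Finset.sum_sub_distrib, hcg, ← hyu u]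
      nth_rw 2 [← hcu u]
      simp [map_sum]
    have := (Finset.sum_eq_zero_iff_of_nonneg fun s hs =>
      mul_nonneg (hc0 u s hs) (sub_nonneg.2 (hys u s hs))).1 hsum s hs
    rcases mul_eq_zero.1 this with h | h
    · exact absurd h hcs
    · linarith
  have hsame : ∀ u u', T u = T u' → gauge P u = y u' u := by
    intro u u' hT
    rw [← hcg u]
    nth_rw 2 [← hcu u]
    rw [map_sum]
    refine Finset.sum_congr rfl fun s hs => ?_
    rw [map_smul, smul_eq_mul]
    by_cases hcs : c u s = 0
    · simp [hcs]
    · have : (⟨s, hs⟩ : S) ∈ T u' := hT ▸ by simp [T, hcs]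
      rw [htight u' s hs (by simpa [T] using this), mul_one]
  obtain ⟨T₀, hT₀⟩ : ∃ T₀, ∃ᶠ δ in 𝓝[>] (0 : ℝ), T (p + δ • v) = T₀ := by
    by_contra! h
    obtain ⟨δ, hδ⟩ := (eventually_all.2 h).exists
    exact hδ _ rfl
  obtain ⟨ε, hε, hε0⟩ := (hT₀.and_eventually self_mem_nhdsWithin).exists
  set z := y (p + ε • v)
  have hfreq : ∃ᶠ δ in 𝓝[>] (0 : ℝ), gauge P (p + δ • v) = z (p + δ • v) :=
    hT₀.mono fun δ hδ => hsame _ _ (hδ.trans hε.symm)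
  have hgc := continuous_gauge hc h0
  have hp : gauge P p = z p := by
    have hclosed : IsClosed {δ : ℝ | gauge P (p + δ • v) = z (p + δ • v)} := by
      simp only [map_add, map_smul, smul_eq_mul]
      exact isClosed_eq (by fun_prop) (by fun_prop)
    have := hclosed.closure_eq ▸ mem_closure_iff_frequently.2 (hfreq.filter_mono nhdsWithin_le_nhds)
    simpa using this
  refine ⟨z, ε, hε0, fun δ hδ => le_antisymm ?_ (hyle _ _)⟩
  have hε0' : (0 : ℝ) < ε := hε0
  have e : p + δ • v = (1 - δ / ε) • p + (δ / ε) • (p + ε • v) := by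
    rw [smul_add, smul_smul, div_mul_cancel₀ _ hε0'.ne', sub_smul, one_smul]
    abel
  have h1 : 0 ≤ 1 - δ / ε := sub_nonneg.2 ((div_le_one hε0').2 hδ.2)
  have h2 : 0 ≤ δ / ε := div_nonneg hδ.1 hε0'.le
  calc gauge P (p + δ • v)
      ≤ gauge P ((1 - δ / ε) • p) + gauge P ((δ / ε) • (p + ε • v)) := by
        rw [e]; exact gauge_add_le hc habs _ _
    _ = z (p + δ • v) := by
        rw [gauge_smul_of_nonneg h1, gauge_smul_of_nonneg h2, hp, hyu (p + ε • v) |>.symm, e]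
        simp [z, mul_add]

theorem mul_eq_mul_of_inv_add_inv_le {a₁ b₁ a₂ b₂ : ℝ} (ha₁ : 0 < a₁) (hb₁ : 0 < b₁)
    (ha₂ : 0 < a₂) (hb₂ : 0 < b₂)
    (h : ((a₁ + a₂)⁻¹ + (b₁ + b₂)⁻¹)⁻¹ ≤ (a₁⁻¹ + b₁⁻¹)⁻¹ + (a₂⁻¹ + b₂⁻¹)⁻¹) :
    b₁ * a₂ = b₂ * a₁ := by
  have key : (a₁⁻¹ + b₁⁻¹)⁻¹ + (a₂⁻¹ + b₂⁻¹)⁻¹ - ((a₁ + a₂)⁻¹ + (b₁ + b₂)⁻¹)⁻¹ =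
      -((b₁ * a₂ - b₂ * a₁) ^ 2 / ((a₁ + b₁) * (a₂ + b₂) * (a₁ + a₂ + (b₁ + b₂)))) := by
    have h₁ : (a₁⁻¹ + b₁⁻¹)⁻¹ = a₁ * b₁ / (a₁ + b₁) := by field_simp; ring
    have h₂ : (a₂⁻¹ + b₂⁻¹)⁻¹ = a₂ * b₂ / (a₂ + b₂) := by field_simp; ring
    have h₃ : ((a₁ + a₂)⁻¹ + (b₁ + b₂)⁻¹)⁻¹ =
        (a₁ + a₂) * (b₁ + b₂) / (a₁ + a₂ + (b₁ + b₂)) := by field_simp; ring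
    rw [h₁, h₂, h₃]
    field_simp
    ring
  have hD : 0 < (a₁ + b₁) * (a₂ + b₂) * (a₁ + a₂ + (b₁ + b₂)) := by positivity
  have hsq : (b₁ * a₂ - b₂ * a₁) ^ 2 / ((a₁ + b₁) * (a₂ + b₂) * (a₁ + a₂ + (b₁ + b₂))) ≤ 0 := by
    linarith
  have := (div_le_iff₀ hD).1 hsq
  nlinarith [sq_nonneg (b₁ * a₂ - b₂ * a₁), pow_eq_zero_iff (two_ne_zero) |>.1
    (le_antisymm (by linarith) (sq_nonneg (b₁ * a₂ - b₂ * a₁)))]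

/-- Along a line missing the origin, `gauge P (-u) / gauge P u` is locally constant to the right. -/
theorem gauge_neg_div_gauge_eventually_eq (S : Finset E)
    (h0 : convexHull ℝ (S : Set E) ∈ 𝓝 (0 : E))
    (hK : Convex ℝ (chordBody (convexHull ℝ (S : Set E)))) {p v : E}
    (hpv : ∀ t : ℝ, p + t • v ≠ 0) :
    ∀ᶠ δ in 𝓝[≥] (0 : ℝ),
      gauge (convexHull ℝ (S : Set E)) (-(p + δ • v)) / gauge (convexHull ℝ (S : Set E)) (p + δ • v)
        = gauge (convexHull ℝ (S : Set E)) (-p) / gauge (convexHull ℝ (S : Set E)) p := by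
  have hP : IsCompact (convexHull ℝ (S : Set E)) := S.finite_toSet.isCompact_convexHull ℝ
  have hc := convex_convexHull ℝ (S : Set E)
  obtain ⟨y, ε, hε, hy⟩ := exists_linearMap_eventually_eq_gauge S h0 p v
  obtain ⟨z, ε', hε', hz⟩ := exists_linearMap_eventually_eq_gauge S h0 (-p) (-v)
  set P := convexHull ℝ (S : Set E)
  filter_upwards [Icc_mem_nhdsGE (lt_min hε hε')] with δ hδ
  have hy' : ∀ r ∈ Icc 0 δ, gauge P (p + r • v) = y (p + r • v) := fun r hr =>
    hy r ⟨hr.1, hr.2.trans (hδ.2.trans (min_le_left _ _))⟩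
  have hz' : ∀ r ∈ Icc 0 δ, gauge P (-(p + r • v)) = z (-(p + r • v)) := fun r hr => by
    have := hz r ⟨hr.1, hr.2.trans (hδ.2.trans (min_le_right _ _))⟩
    rwa [smul_neg, ← neg_add] at this
  have hp0 : p ≠ 0 := by simpa using hpv 0
  have hg := fun r => gauge_pos_of_isCompact hP h0 (hpv r)
  have hg' := fun r => gauge_pos_of_isCompact hP h0 (neg_ne_zero.2 (hpv r))
  have hgp := gauge_pos_of_isCompact hP h0 hp0
  have hgp' := gauge_pos_of_isCompact hP h0 (neg_ne_zero.2 hp0)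
  have hmid : p + (p + δ • v) = (2 : ℝ) • (p + (δ / 2) • v) := by
    rw [smul_add, smul_smul, two_smul, mul_div_cancel₀ _ two_ne_zero, add_assoc]
  have hmem2 : δ / 2 ∈ Icc 0 δ := ⟨by linarith [hδ.1], by linarith [hδ.1]⟩
  have hmemδ : δ ∈ Icc 0 δ := ⟨hδ.1, le_rfl⟩
  have hmem0 : (0 : ℝ) ∈ Icc 0 δ := ⟨le_rfl, hδ.1⟩
  have hadd : gauge P (p + (p + δ • v)) = gauge P p + gauge P (p + δ • v) := by
    have e := hy' 0 hmem0
    rw [zero_smul, add_zero] at e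
    rw [hy' δ hmemδ, e, hmid, gauge_smul_of_nonneg zero_le_two, hy' _ hmem2, smul_eq_mul,
      ← map_add, hmid, map_smul, smul_eq_mul]
  have hadd' : gauge P (-(p + (p + δ • v))) = gauge P (-p) + gauge P (-(p + δ • v)) := by
    have e := hz' 0 hmem0
    rw [zero_smul, add_zero] at e
    rw [hz' δ hmemδ, e, hmid, ← smul_neg, gauge_smul_of_nonneg zero_le_two, hz' _ hmem2,
      smul_eq_mul, ← map_add, ← neg_add, hmid, ← smul_neg, map_smul, smul_eq_mul]
  have hne : p + (p + δ • v) ≠ 0 := hmid ▸ smul_ne_zero two_ne_zero (hpv _)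
  have h := (inv_chord_add_le hK (u := p) (v := p + δ • v)
    (by rw [chord_eq_inv_gauge_add hP hc h0 hp0]; positivity)
    (by rw [chord_eq_inv_gauge_add hP hc h0 (hpv δ)]; have := hg δ; have := hg' δ; positivity)
    hne).2
  rw [chord_eq_inv_gauge_add hP hc h0 hp0, chord_eq_inv_gauge_add hP hc h0 (hpv δ),
    chord_eq_inv_gauge_add hP hc h0 hne, hadd, hadd'] at h
  have := mul_eq_mul_of_inv_add_inv_le hgp hgp' (hg δ) (hg' δ) h
  rw [div_eq_div_iff (hg δ).ne' hgp.ne', this]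

theorem gauge_neg_div_gauge_eq_of_forall_ne_zero (S : Finset E)
    (h0 : convexHull ℝ (S : Set E) ∈ 𝓝 (0 : E))
    (hK : Convex ℝ (chordBody (convexHull ℝ (S : Set E)))) {p v : E}
    (hpv : ∀ t : ℝ, p + t • v ≠ 0) :
    gauge (convexHull ℝ (S : Set E)) (-(p + v)) / gauge (convexHull ℝ (S : Set E)) (p + v)
      = gauge (convexHull ℝ (S : Set E)) (-p) / gauge (convexHull ℝ (S : Set E)) p := by
  have hP : IsCompact (convexHull ℝ (S : Set E)) := S.finite_toSet.isCompact_convexHull ℝ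
  have hgc := continuous_gauge (convex_convexHull ℝ (S : Set E)) h0
  have hloc := fun q => gauge_neg_div_gauge_eventually_eq S h0 hK (p := q) (v := v)
  set P := convexHull ℝ (S : Set E)
  let q : ℝ → ℝ := fun t => gauge P (-(p + t • v)) / gauge P (p + t • v)
  have hq : Continuous q :=
    Continuous.div (by fun_prop) (by fun_prop) fun t => (gauge_pos_of_isCompact hP h0 (hpv t)).ne'
  have h := constant_of_has_deriv_right_zero (f := q) (a := 0) (b := 1) hq.continuousOn
    (fun t _ => by
      have e : ∀ δ : ℝ, p + t • v + δ • v = p + (t + δ) • v := fun δ => by rw [add_assoc, add_smul]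
      have hl := hloc (p + t • v) fun δ => e δ ▸ hpv _
      simp_rw [e] at hl
      have hsub : Tendsto (fun x => x - t) (𝓝[≥] t) (𝓝[≥] 0) := by
        refine tendsto_nhdsWithin_iff.2 ⟨?_, ?_⟩
        · have : Continuous fun x : ℝ => x - t := by fun_prop
          simpa using (this.tendsto t).mono_left nhdsWithin_le_nhds
        · filter_upwards [self_mem_nhdsWithin] with x hx
          exact sub_nonneg.2 (mem_Ici.1 hx)
      have heq : q =ᶠ[𝓝[≥] t] fun _ => q t := by
        filter_upwards [hsub.eventually hl] with x hx
        simpa [q] using hx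
      exact (hasDerivWithinAt_const t (Ici t) (q t)).congr_of_eventuallyEq heq rfl) 1 (by simp)
  simpa [q] using h

theorem eq_neg_of_convex_chordBody (S : Finset E)
    (h0 : convexHull ℝ (S : Set E) ∈ 𝓝 (0 : E))
    (hdim : ∀ u : E, u ≠ 0 → ∃ w, LinearIndependent ℝ ![u, w])
    (hK : Convex ℝ (chordBody (convexHull ℝ (S : Set E)))) :
    convexHull ℝ (S : Set E) = -convexHull ℝ (S : Set E) := by
  have hP : IsCompact (convexHull ℝ (S : Set E)) := S.finite_toSet.isCompact_convexHull ℝ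
  have hc := convex_convexHull ℝ (S : Set E)
  have hconst := fun p v => gauge_neg_div_gauge_eq_of_forall_ne_zero S h0 hK (p := p) (v := v)
  set P := convexHull ℝ (S : Set E)
  have hgauge : ∀ u, gauge P (-u) = gauge P u := by
    intro u
    rcases eq_or_ne u 0 with rfl | hu
    · simp
    obtain ⟨w, hw⟩ := hdim u hu
    rw [LinearIndependent.pair_iff] at hw
    have h1 := hconst u (w - u) fun t ht => by
      have := hw (1 - t) t (by rw [← ht]; module)
      linarith [this.1, this.2]
    have h2 := hconst (-u) (w + u) fun t ht => by
      have := hw (t - 1) t (by rw [← ht]; module)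
      linarith [this.1, this.2]
    rw [add_sub_cancel] at h1
    rw [neg_add_cancel_comm_assoc, neg_neg, h1] at h2
    have hg := gauge_pos_of_isCompact hP h0 hu
    have hg' := gauge_pos_of_isCompact hP h0 (neg_ne_zero.2 hu)
    rw [div_eq_div_iff hg.ne' hg'.ne'] at h2
    nlinarith
  ext x
  rw [Set.mem_neg, mem_iff_gauge_le_one hP hc h0, mem_iff_gauge_le_one hP hc h0, hgauge]

theorem zero_mem_interior_of_eq_neg {P : Set E} (hc : Convex ℝ P) (hne : (interior P).Nonempty)
    (hsymm : P = -P) : (0 : E) ∈ interior P := by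
  obtain ⟨p, hp⟩ := hne
  have hp' : -p ∈ interior P := by
    have h := (Homeomorph.neg E).preimage_interior P
    change -interior P = interior (-P) at h
    rw [← Set.mem_neg, h, ← hsymm]
    exact hp
  simpa using hc.interior.midpoint_mem hp hp'

/-- Rotation of the Euclidean plane by a right angle. -/
def quarterTurn : EuclideanSpace ℝ (Fin 2) →ₗ[ℝ] EuclideanSpace ℝ (Fin 2) where
  toFun x := !₂[-x 1, x 0]
  map_add' x y := by ext i; fin_cases i <;> simp [add_comm]
  map_smul' c x := by ext i; fin_cases i <;> simp

theorem quarterTurn_quarterTurn (x : EuclideanSpace ℝ (Fin 2)) :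
    quarterTurn (quarterTurn x) = -x := by
  ext i; fin_cases i <;> simp [quarterTurn]

theorem norm_quarterTurn (x : EuclideanSpace ℝ (Fin 2)) : ‖quarterTurn x‖ = ‖x‖ := by
  simp [quarterTurn, EuclideanSpace.norm_eq, add_comm]

theorem sq_add_sq_pos_of_ne_zero {x : EuclideanSpace ℝ (Fin 2)} (hx : x ≠ 0) :
    0 < x 0 ^ 2 + x 1 ^ 2 := by
  have := EuclideanSpace.real_norm_sq_eq x
  rw [Fin.sum_univ_two] at this
  rw [← this]
  have := norm_pos_iff.2 hx
  positivity

theorem perp_eq_range_smul_quarterTurn {x : EuclideanSpace ℝ (Fin 2)} (hx : x ≠ 0) :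
    perp x = range fun t : ℝ => t • quarterTurn x := by
  have hpos := sq_add_sq_pos_of_ne_zero hx
  ext y
  simp only [perp, mem_ofPred_eq, mem_range, PiLp.inner_apply, Fin.sum_univ_two,
    RCLike.inner_apply, conj_trivial]
  constructor
  · intro h
    refine ⟨(x 0 * y 1 - x 1 * y 0) / (x 0 ^ 2 + x 1 ^ 2), ?_⟩
    ext i
    fin_cases i <;> simp [quarterTurn] <;> field_simp
    · linear_combination (-(x 0)) * h
    · linear_combination (-(x 1)) * h
  · rintro ⟨t, rfl⟩
    simp [quarterTurn]
    ring

theorem radialFn_one_eq_chord (P : Set (EuclideanSpace ℝ (Fin 2)))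
    {x : EuclideanSpace ℝ (Fin 2)} (hx : x ≠ 0) :
    radialFn 1 P x = chord P (quarterTurn x) := by
  have h : P ∩ perp x =
      (fun t : ℝ => t • quarterTurn x) '' {t : ℝ | t • quarterTurn x ∈ P} := by
    rw [perp_eq_range_smul_quarterTurn hx]
    exact (image_preimage_eq_inter_range).symm
  rw [radialFn, h, hausdorffMeasure_smul_right_image, hausdorffMeasure_real, ENNReal.smul_def,
    smul_eq_mul, ENNReal.toReal_mul, chord]
  have hn : ‖x‖ ≠ 0 := norm_ne_zero_iff.2 hx
  simp [norm_quarterTurn, hn]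

theorem ibody_one_eq_preimage_chordBody (P : Set (EuclideanSpace ℝ (Fin 2))) :
    ibody 1 P = quarterTurn ⁻¹' chordBody P := by
  ext x
  rcases eq_or_ne x 0 with rfl | hx
  · simp [ibody, chordBody]
  · have hq : quarterTurn x ≠ 0 := by rw [← norm_ne_zero_iff, norm_quarterTurn]; simpa
    simp [ibody, chordBody, hx, hq, radialFn_one_eq_chord P hx]

theorem convex_ibody_one_iff (P : Set (EuclideanSpace ℝ (Fin 2))) :
    Convex ℝ (ibody 1 P) ↔ Convex ℝ (chordBody P) := by
  refine ⟨fun h => ?_, fun h => ?_⟩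
  · have e : chordBody P = quarterTurn ⁻¹' ibody 1 P := by
      ext x
      simp [ibody_one_eq_preimage_chordBody, quarterTurn_quarterTurn, chordBody, chord_neg]
    rw [e]
    exact h.linear_preimage _
  · rw [ibody_one_eq_preimage_chordBody]
    exact h.linear_preimage _

theorem linearIndependent_quarterTurn {u : EuclideanSpace ℝ (Fin 2)} (hu : u ≠ 0) :
    LinearIndependent ℝ ![u, quarterTurn u] := by
  have hpos := sq_add_sq_pos_of_ne_zero hu
  rw [LinearIndependent.pair_iff]
  intro a b h
  have h0 := congrArg (fun x : EuclideanSpace ℝ (Fin 2) => x 0) h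
  have h1 := congrArg (fun x : EuclideanSpace ℝ (Fin 2) => x 1) h
  simp [quarterTurn] at h0 h1
  exact ⟨mul_right_cancel₀ hpos.ne' (by linear_combination u 0 * h0 + u 1 * h1),
    mul_right_cancel₀ hpos.ne' (by linear_combination u 0 * h1 - u 1 * h0)⟩

theorem exists_ne_zero_apply_eq_zero (φ : EuclideanSpace ℝ (Fin 2) →L[ℝ] ℝ) :
    ∃ w ≠ 0, φ w = 0 := by
  have h := LinearMap.ker_ne_bot_of_finrank_lt (f := φ.toLinearMap) (by simp)
  obtain ⟨w, hw, hw0⟩ := Submodule.exists_mem_ne_zero_of_ne_bot h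
  exact ⟨w, hw0, hw⟩

/-- Let `P ⊆ ℝ²` be a polygon (a full-dimensional compact convex polytope).
Then the intersection body `IP` is convex if and only if `P = -P`. -/
theorem statement_0 (P : Set (EuclideanSpace ℝ (Fin 2)))
    (hpoly : IsPolytope P) (hfull : (interior P).Nonempty) :
    Convex ℝ (ibody 1 P) ↔ P = -P := by
  obtain ⟨S, rfl⟩ := hpoly
  have hP : IsCompact (convexHull ℝ (S : Set (EuclideanSpace ℝ (Fin 2)))) :=
    S.finite_toSet.isCompact_convexHull ℝ
  have hc := convex_convexHull ℝ (S : Set (EuclideanSpace ℝ (Fin 2)))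
  rw [convex_ibody_one_iff]
  refine ⟨fun hK => ?_, fun hsymm => ?_⟩
  · exact eq_neg_of_convex_chordBody S
      (mem_interior_iff_mem_nhds.1 (zero_mem_interior_of_convex_chordBody hP hc hfull
        exists_ne_zero_apply_eq_zero hK))
      (fun u hu => ⟨quarterTurn u, linearIndependent_quarterTurn hu⟩) hK
  · exact convex_chordBody_of_eq_neg hP hc
      (mem_interior_iff_mem_nhds.1 (zero_mem_interior_of_eq_neg hc hfull hsymm)) hsymm
end
end

section
/- Let d ≥ 2 and let P = [a₁,b₁] × [a₂,b₂] × ⋯ × [a_d,b_d] ⊆ ℝ^d with aᵢ < bᵢ for all i be a d-dimensional axis-parallel parallelepiped. Then the intersection body IP is convex if and only if P = −P, i.e., if and only if aᵢ = −bᵢ for all i. -/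
open MeasureTheory
open scoped RealInnerProductSpace

noncomputable section

open Filter Topology in
lemma exists_cdf_of_density {f : ℝ → ℝ} (hc : Continuous f) (hp : ∀ u, 0 < f u)
    (hi : Integrable f) :
    ∃ Φ : ℝ → ℝ, (∀ u, HasStrictDerivAt Φ (f u / ∫ v, f v) u) ∧ StrictMono Φ ∧
      Tendsto Φ atBot (𝓝 0) ∧ Tendsto Φ atTop (𝓝 1) ∧ ∀ u, 0 < Φ u ∧ Φ u < 1 := by
  have hI : 0 < ∫ v, f v := integral_pos_of_integrable_nonneg_nonzero hc hi
    (fun u => (hp u).le) (hp 0).ne'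
  set I := ∫ v, f v with hIdef
  set L := ∫ v in Set.Iic (0 : ℝ), f v with hL
  have hLR : L + ∫ v in Set.Ioi (0 : ℝ), f v = I :=
    intervalIntegral.integral_Iic_add_Ioi hi.integrableOn hi.integrableOn
  let Φ : ℝ → ℝ := fun u => (L + ∫ v in (0 : ℝ)..u, f v) / I
  have hd : ∀ u, HasStrictDerivAt Φ (f u / I) u := fun u =>
    ((hc.integral_hasStrictDerivAt 0 u).const_add L).div_const I
  have hm : StrictMono Φ := strictMono_of_hasDerivAt_pos (fun u => (hd u).hasDerivAt)
    (fun u => div_pos (hp u) hI)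
  have hbot : Tendsto Φ atBot (𝓝 0) := by
    have h1 := intervalIntegral_tendsto_integral_Iic (0 : ℝ) (hi.integrableOn (s := Set.Iic 0))
      (tendsto_id (α := ℝ) (x := atBot))
    have h2 := ((h1.neg.const_add L).div_const I)
    simp only [id, ← intervalIntegral.integral_symm] at h2
    simpa [Φ, ← hL] using h2
  have htop : Tendsto Φ atTop (𝓝 1) := by
    have h1 := intervalIntegral_tendsto_integral_Ioi (0 : ℝ) (hi.integrableOn (s := Set.Ioi 0))
      (tendsto_id (α := ℝ) (x := atTop))
    have h2 := ((h1.const_add L).div_const I)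
    rw [hLR, div_self hI.ne'] at h2
    exact h2
  refine ⟨Φ, hd, hm, hbot, htop, fun u => ⟨?_, ?_⟩⟩
  · exact (hm.monotone.le_of_tendsto hbot (u - 1)).trans_lt (hm (by linarith))
  · exact (hm (by linarith : u < u + 1)).trans_le (hm.monotone.ge_of_tendsto htop (u + 1))

open Filter Topology in
lemma exists_monotone_transport {f g : ℝ → ℝ} (hf : Continuous f) (hf0 : ∀ u, 0 < f u)
    (hfi : Integrable f) (hg : Continuous g) (hg0 : ∀ u, 0 < g u) (hgi : Integrable g) :
    ∃ T : ℝ → ℝ, StrictMono T ∧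
      ∀ u, HasDerivAt T ((f u / ∫ v, f v) / (g (T u) / ∫ v, g v)) u := by
  obtain ⟨Φ, hΦ, hΦm, hΦb, hΦt, hΦ01⟩ := exists_cdf_of_density hf hf0 hfi
  obtain ⟨Ψ, hΨ, hΨm, hΨb, hΨt, hΨ01⟩ := exists_cdf_of_density hg hg0 hgi
  have hΨc : Continuous Ψ := continuous_iff_continuousAt.2 fun u => (hΨ u).hasDerivAt.continuousAt
  have hΦc : Continuous Φ := continuous_iff_continuousAt.2 fun u => (hΦ u).hasDerivAt.continuousAt
  have surj : ∀ {F : ℝ → ℝ}, Continuous F → Tendsto F atBot (𝓝 0) → Tendsto F atTop (𝓝 1) →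
      ∀ c, 0 < c → c < 1 → ∃ u, F u = c := by
    intro F hF hb ht c h0 h1
    exact mem_range_of_exists_le_of_exists_ge hF
      ((hb.eventually_lt_const h0).exists.imp fun _ h => h.le)
      ((ht.eventually_const_lt h1).exists.imp fun _ h => h.le)
  choose T hT using fun u => surj hΨc hΨb hΨt (Φ u) (hΦ01 u).1 (hΦ01 u).2
  have hTm : StrictMono T := fun u v huv => by
    rw [← hΨm.lt_iff_lt, hT, hT]; exact hΦm huv
  have hTs : Function.Surjective T := fun w => by
    obtain ⟨u, hu⟩ := surj hΦc hΦb hΦt (Ψ w) (hΨ01 w).1 (hΨ01 w).2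
    exact ⟨u, hΨm.injective (by rw [hT, hu])⟩
  have hTc : Continuous T := hTm.monotone.continuous_of_surjective hTs
  refine ⟨T, hTm, fun u => ?_⟩
  have hgI : 0 < ∫ v, g v := integral_pos_of_integrable_nonneg_nonzero hg hgi
    (fun u => (hg0 u).le) (hg0 0).ne'
  have hne : g (T u) / ∫ v, g v ≠ 0 := (div_pos (hg0 _) hgI).ne'
  have h1 := ((hΨ (T u)).to_localInverse hne).hasDerivAt
  rw [hT u] at h1
  have h2 := h1.comp u (hΦ u).hasDerivAt
  have h3 := hTc.continuousAt.eventually ((hΨ (T u)).eventually_left_inverse hne)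
  rw [div_eq_inv_mul]
  refine h2.congr_of_eventuallyEq ?_
  filter_upwards [h3] with y hy
  simp only [Function.comp, ← hT y, hy]

/-- Hölder's inequality in the form of convexity of `(a, p) ↦ a ^ (k + 1) / p ^ k`. -/
lemma pow_div_pow_add_le {k : ℕ} {s t a b p q : ℝ} (hs : 0 ≤ s) (ht : 0 ≤ t) (hst : s + t = 1)
    (ha : 0 < a) (hb : 0 < b) (hp : 0 < p) (hq : 0 < q) :
    (s * a + t * b) ^ (k + 1) / (s * p + t * q) ^ k ≤
      s * (a ^ (k + 1) / p ^ k) + t * (b ^ (k + 1) / q ^ k) := by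
  have hD : 0 < s * p + t * q := by
    rcases hs.eq_or_lt with h | h
    · have : t = 1 := by linarith
      subst this; rw [← h]; simpa using hq
    · positivity
  have h := (convexOn_pow (𝕜 := ℝ) (k + 1)).2
    (Set.mem_Ici.2 (show 0 ≤ a / p by positivity)) (Set.mem_Ici.2 (show 0 ≤ b / q by positivity))
    (show 0 ≤ s * p / (s * p + t * q) by positivity)
    (show 0 ≤ t * q / (s * p + t * q) by positivity) (by field_simp)
  simp only [smul_eq_mul] at h
  have e1 : s * p / (s * p + t * q) * (a / p) + t * q / (s * p + t * q) * (b / q) =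
      (s * a + t * b) / (s * p + t * q) := by field_simp
  have e2 : s * p / (s * p + t * q) * (a / p) ^ (k + 1) +
      t * q / (s * p + t * q) * (b / q) ^ (k + 1) =
      (s * (a ^ (k + 1) / p ^ k) + t * (b ^ (k + 1) / q ^ k)) / (s * p + t * q) := by
    rw [div_pow, div_pow, pow_succ p, pow_succ q]
    field_simp
  rw [e1, e2, div_pow, le_div_iff₀ hD] at h
  calc _ = (s * a + t * b) ^ (k + 1) / (s * p + t * q) ^ (k + 1) * (s * p + t * q) := by
        rw [pow_succ (s * p + t * q)]
        field_simp
    _ ≤ _ := h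

/-- One-dimensional Borell–Brascamp–Lieb inequality with exponent `-1 / (k + 1)`. -/
lemma borell_brascamp_lieb_real {k : ℕ} {s t P Q : ℝ} (hs : 0 < s) (ht : 0 < t) (hst : s + t = 1)
    {h₀ h₁ h : ℝ → ℝ} (c₀ : Continuous h₀) (c₁ : Continuous h₁)
    (p₀ : ∀ u, 0 < h₀ u) (p₁ : ∀ u, 0 < h₁ u) (p : ∀ u, 0 < h u)
    (i₀ : Integrable fun u => (h₀ u ^ (k + 1))⁻¹) (i₁ : Integrable fun u => (h₁ u ^ (k + 1))⁻¹)
    (i : Integrable fun u => (h u ^ (k + 1))⁻¹)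
    (hle : ∀ u v, h (s * u + t * v) ≤ s * h₀ u + t * h₁ v)
    (hP : 0 < P) (hQ : 0 < Q)
    (hPI : ∫ u, (h₀ u ^ (k + 1))⁻¹ = (P ^ k)⁻¹) (hQI : ∫ u, (h₁ u ^ (k + 1))⁻¹ = (Q ^ k)⁻¹) :
    ((s * P + t * Q) ^ k)⁻¹ ≤ ∫ u, (h u ^ (k + 1))⁻¹ := by
  obtain ⟨T, hT, hTd⟩ := exists_monotone_transport (f := fun u => (h₀ u ^ (k + 1))⁻¹)
    (g := fun u => (h₁ u ^ (k + 1))⁻¹)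
    ((c₀.pow _).inv₀ fun u => (pow_pos (p₀ u) _).ne') (fun u => inv_pos.2 (pow_pos (p₀ u) _)) i₀
    ((c₁.pow _).inv₀ fun u => (pow_pos (p₁ u) _).ne') (fun u => inv_pos.2 (pow_pos (p₁ u) _)) i₁
  rw [hPI, hQI] at hTd
  set T' : ℝ → ℝ := fun u => (h₀ u ^ (k + 1))⁻¹ / (P ^ k)⁻¹ / ((h₁ (T u) ^ (k + 1))⁻¹ / (Q ^ k)⁻¹)
    with hT'
  have hT'0 : ∀ u, 0 < T' u := fun u => by
    have := p₀ u; have := p₁ (T u); positivity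
  set w : ℝ → ℝ := fun u => s * u + t * T u with hw
  set w' : ℝ → ℝ := fun u => s + t * T' u with hw'
  have hw'0 : ∀ u, 0 < w' u := fun u => by have := hT'0 u; positivity
  have hwd : ∀ u, HasDerivAt w (w' u) u := fun u => by
    have := ((hasDerivAt_id u).const_mul s).add ((hTd u).const_mul t)
    rw [mul_one] at this
    exact this
  have hwm : StrictMono w := strictMono_of_hasDerivAt_pos hwd hw'0
  have key : ∀ u, ((s * P + t * Q) ^ k)⁻¹ * (P ^ k * (h₀ u ^ (k + 1))⁻¹) ≤
      |w' u| * (h (w u) ^ (k + 1))⁻¹ := fun u => by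
    have ha := p₀ u
    have hb := p₁ (T u)
    have hh := p (w u)
    have hD : 0 < s * P + t * Q := by positivity
    have hN : 0 < s * h₀ u + t * h₁ (T u) := by positivity
    rw [abs_of_pos (hw'0 u)]
    have h1 : (h (w u) ^ (k + 1)) ≤ (s * h₀ u + t * h₁ (T u)) ^ (k + 1) :=
      pow_le_pow_left₀ hh.le (hle u (T u)) _
    have h2 := pow_div_pow_add_le (k := k) hs.le ht.le hst ha hb hP hQ
    have h3 : w' u = (s * (h₀ u ^ (k + 1) / P ^ k) + t * (h₁ (T u) ^ (k + 1) / Q ^ k)) *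
        (P ^ k * (h₀ u ^ (k + 1))⁻¹) := by
      simp only [hw', hT']
      field_simp
    rw [h3, mul_right_comm]
    refine mul_le_mul_of_nonneg_right ?_ (by positivity)
    rw [← div_eq_mul_inv, le_div_iff₀ (by positivity), inv_mul_eq_div]
    exact (div_le_div_of_nonneg_right h1 (by positivity)).trans h2
  have hint : IntegrableOn (fun u => |w' u| • (h (w u) ^ (k + 1))⁻¹) Set.univ :=
    (integrableOn_image_iff_integrableOn_abs_deriv_smul MeasurableSet.univ
      (fun u _ => (hwd u).hasDerivWithinAt) hwm.injective.injOn
      (fun u => (h u ^ (k + 1))⁻¹)).1 i.integrableOn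
  calc ((s * P + t * Q) ^ k)⁻¹
      = ∫ u, ((s * P + t * Q) ^ k)⁻¹ * (P ^ k * (h₀ u ^ (k + 1))⁻¹) := by
        rw [integral_const_mul, integral_const_mul, hPI]; field_simp
    _ ≤ ∫ u, |w' u| • (h (w u) ^ (k + 1))⁻¹ :=
        integral_mono ((i₀.const_mul _).const_mul _) (integrableOn_univ.1 hint) key
    _ = ∫ u in w '' Set.univ, (h u ^ (k + 1))⁻¹ := by
        rw [integral_image_eq_integral_abs_deriv_smul MeasurableSet.univ
          (fun u _ => (hwd u).hasDerivWithinAt) hwm.injective.injOn, Measure.restrict_univ]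
    _ ≤ ∫ u, (h u ^ (k + 1))⁻¹ :=
        setIntegral_le_integral i (Filter.Eventually.of_forall fun u => by
          have := p u; simp only [Pi.zero_apply]; positivity)

lemma ConvexOn.continuous_slice {X : Type*} [NormedAddCommGroup X] [NormedSpace ℝ X]
    {Y : Type*} [NormedAddCommGroup Y] [NormedSpace ℝ Y] [FiniteDimensional ℝ Y]
    {h : X × Y → ℝ} (hc : ConvexOn ℝ Set.univ h) (x : X) : Continuous fun y => h (x, y) := by
  rw [← continuousOn_univ]
  refine ConvexOn.continuousOn isOpen_univ ⟨convex_univ, fun u _ v _ a b ha hb hab => ?_⟩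
  have := hc.2 (Set.mem_univ (x, u)) (Set.mem_univ (x, v)) ha hb hab
  rwa [Prod.smul_mk, Prod.smul_mk, Prod.mk_add_mk, Convex.combo_self hab] at this

lemma integrable_inv_pow_of_le {Y : Type*} [NormedAddCommGroup Y] [NormedSpace ℝ Y]
    [FiniteDimensional ℝ Y] [MeasureSpace Y] [BorelSpace Y]
    [(volume : Measure Y).IsAddHaarMeasure] {f : Y → ℝ} {c : ℝ} {k : ℕ} (hf : Continuous f)
    (hk : Module.finrank ℝ Y < k) (hc : 0 < c) (hle : ∀ y, c * (1 + ‖y‖) ≤ f y) :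
    Integrable fun y => (f y ^ k)⁻¹ := by
  have hpos : ∀ y, 0 < f y := fun y => lt_of_lt_of_le (by positivity) (hle y)
  have h1 := (integrable_one_add_norm (E := Y) (μ := volume) (r := k)
    (by exact_mod_cast hk)).const_mul (c ^ k)⁻¹
  refine h1.mono' ((hf.pow k).inv₀ fun y => (pow_pos (hpos y) k).ne').aestronglyMeasurable ?_
  refine Filter.Eventually.of_forall fun y => ?_
  have h0 : (0 : ℝ) < 1 + ‖y‖ := by positivity
  rw [Real.norm_of_nonneg (inv_nonneg.2 (pow_pos (hpos y) k).le), Real.rpow_neg h0.le,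
    Real.rpow_natCast, ← mul_inv, ← mul_pow]
  exact inv_anti₀ (by positivity) (pow_le_pow_left₀ (by positivity) (hle y) k)

/-- Integrating out one real variable maps `(-1 / (k + 1))`-concave functions to
`(-1 / k)`-concave ones. -/
lemma exists_convexOn_integral_real {X : Type*} [NormedAddCommGroup X] [NormedSpace ℝ X] {k : ℕ}
    (hk : 1 ≤ k) {h : X × ℝ → ℝ} (hc : ConvexOn ℝ Set.univ h) {c : ℝ} (c0 : 0 < c)
    (hle : ∀ y, c * (1 + ‖y‖) ≤ h y) :
    ∃ H : X → ℝ, ConvexOn ℝ Set.univ H ∧ (∃ c' > 0, ∀ x, c' * (1 + ‖x‖) ≤ H x) ∧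
      ∀ x, ∫ w, (h (x, w) ^ (k + 1))⁻¹ = (H x ^ k)⁻¹ := by
  have hk0 : k ≠ 0 := by omega
  have hpos : ∀ y, 0 < h y := fun y => lt_of_lt_of_le (by positivity) (hle y)
  have hcont := hc.continuous_slice
  have hint : ∀ x, Integrable fun w => (h (x, w) ^ (k + 1))⁻¹ := fun x =>
    integrable_inv_pow_of_le (c := c) (hcont x) (by simp; omega) c0 fun w =>
      (mul_le_mul_of_nonneg_left (by gcongr; exact le_max_right _ _) c0.le).trans (hle (x, w))
  have hIpos : ∀ x, 0 < ∫ w, (h (x, w) ^ (k + 1))⁻¹ := fun x =>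
    integral_pos_of_integrable_nonneg_nonzero
      (((hcont x).pow _).inv₀ fun w => (pow_pos (hpos _) _).ne') (hint x)
      (fun w => inv_nonneg.2 (pow_pos (hpos _) _).le)
      (inv_ne_zero (pow_pos (hpos (x, (0 : ℝ))) _).ne')
  have root : ∀ r : ℝ, 0 < r → ∃ a, 0 < a ∧ a ^ k = r := fun r hr =>
    ⟨r ^ ((k : ℝ)⁻¹), Real.rpow_pos_of_pos hr _, Real.rpow_inv_natCast_pow hr.le hk0⟩
  choose H H0 hH using fun x => root _ (inv_pos.2 (hIpos x))
  have hHI : ∀ x, ∫ w, (h (x, w) ^ (k + 1))⁻¹ = (H x ^ k)⁻¹ := fun x => by rw [hH, inv_inv]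
  refine ⟨H, ⟨convex_univ, ?_⟩, ?_, hHI⟩
  · intro x _ y _ s t hs ht hst
    rcases hs.eq_or_lt with rfl | hs
    · obtain rfl : t = 1 := by linarith
      simp
    rcases ht.eq_or_lt with rfl | ht
    · obtain rfl : s = 1 := by linarith
      simp
    have hb := borell_brascamp_lieb_real (k := k) hs ht hst (hcont x) (hcont y)
      (fun _ => hpos _) (fun _ => hpos _) (h := fun w => h (s • x + t • y, w)) (fun _ => hpos _)
      (hint x) (hint y) (hint _) (fun u v => ?_) (H0 x) (H0 y) (hHI x) (hHI y)
    · rw [hHI, inv_le_inv₀ (by have := H0 x; have := H0 y; positivity) (pow_pos (H0 _) _)] at hb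
      exact le_of_pow_le_pow_left₀ hk0
        (by have := H0 x; have := H0 y; simp only [smul_eq_mul]; positivity) hb
    · exact hc.2 (Set.mem_univ (x, u)) (Set.mem_univ (y, v)) hs.le ht.le hst
  · set M := ∫ w : ℝ, ((1 + ‖w‖) ^ (k + 1))⁻¹ with hM
    have hMi : Integrable fun w : ℝ => ((1 + ‖w‖) ^ (k + 1))⁻¹ :=
      integrable_inv_pow_of_le (c := 1) (by fun_prop) (by simp; omega) one_pos fun w => by simp
    have hM0 : 0 < M := integral_pos_of_integrable_nonneg_nonzero
      (Continuous.inv₀ (by fun_prop) fun w => by positivity) hMi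
      (fun w => by simp only [Pi.zero_apply]; positivity)
      (x := 0) (by simp)
    obtain ⟨c', c'0, hc'⟩ := root ((c / 2) ^ (k + 1) / M) (by positivity)
    refine ⟨c', c'0, fun x => ?_⟩
    set A := 1 + ‖x‖ with hA
    have hA0 : 0 < A := by positivity
    have hint2 : Integrable fun w : ℝ =>
        ((c / 2 * A) ^ (k + 1))⁻¹ * ((1 + ‖A⁻¹ * w‖) ^ (k + 1))⁻¹ :=
      (hMi.comp_mul_left' (inv_ne_zero hA0.ne')).const_mul _
    have h1 : ∫ w, (h (x, w) ^ (k + 1))⁻¹ ≤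
        ∫ w : ℝ, ((c / 2 * A) ^ (k + 1))⁻¹ * ((1 + ‖A⁻¹ * w‖) ^ (k + 1))⁻¹ := by
      refine integral_mono (hint x) hint2 fun w => ?_
      simp only
      rw [← mul_inv, ← mul_pow]
      refine inv_anti₀ (by positivity)
        (pow_le_pow_left₀ (by positivity) (le_trans ?_ (hle (x, w))) _)
      have e : c / 2 * A * (1 + ‖A⁻¹ * w‖) = c / 2 * (A + ‖w‖) := by
        rw [norm_mul, norm_inv, Real.norm_of_nonneg hA0.le]; field_simp
      have m1 : ‖x‖ ≤ ‖(x, w)‖ := le_max_left _ _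
      have m2 : ‖w‖ ≤ ‖(x, w)‖ := le_max_right _ _
      rw [e]
      nlinarith
    rw [integral_const_mul, Measure.integral_comp_mul_left (fun w : ℝ => ((1 + ‖w‖) ^ (k + 1))⁻¹),
      ← hM, hHI, inv_inv, abs_of_pos hA0, smul_eq_mul] at h1
    refine le_of_pow_le_pow_left₀ hk0 (H0 x).le ?_
    rw [mul_pow, hc']
    have h2 : ((c / 2 * A) ^ (k + 1))⁻¹ * (A * M) = ((c / 2) ^ (k + 1) / M * A ^ k)⁻¹ := by
      rw [mul_pow, pow_succ A]; field_simp
    rwa [h2, inv_le_inv₀ (pow_pos (H0 x) _) (by positivity)] at h1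

lemma exists_convexOn_integral_pi (n : ℕ) : ∀ {X : Type} [NormedAddCommGroup X]
    [NormedSpace ℝ X] {k : ℕ} (_ : 1 ≤ k) {h : X × (Fin n → ℝ) → ℝ}
    (_ : ConvexOn ℝ Set.univ h) {c : ℝ} (_ : 0 < c) (_ : ∀ y, c * (1 + ‖y‖) ≤ h y),
    ∃ H : X → ℝ, ConvexOn ℝ Set.univ H ∧ (∃ c' > 0, ∀ x, c' * (1 + ‖x‖) ≤ H x) ∧
      ∀ x, ∫ z, (h (x, z) ^ (n + k))⁻¹ = (H x ^ k)⁻¹ := by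
  induction n with
  | zero =>
    intro X _ _ k hk h hc c c0 hle
    refine ⟨fun x => h (x, 0), ⟨convex_univ, fun x _ y _ s t hs ht hst => ?_⟩,
      ⟨c, c0, fun x => ?_⟩, fun x => ?_⟩
    · simpa using hc.2 (Set.mem_univ (x, 0)) (Set.mem_univ (y, 0)) hs ht hst
    · exact (mul_le_mul_of_nonneg_left (by gcongr; exact le_max_left _ _) c0.le).trans (hle (x, 0))
    · rw [Measure.volume_pi_eq_dirac (0 : Fin 0 → ℝ), integral_dirac, zero_add]
  | succ n ih =>
    intro X _ _ k hk h hc c c0 hle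
    let L : (X × (Fin n → ℝ)) × ℝ →ₗ[ℝ] X × (Fin (n + 1) → ℝ) :=
      { toFun := fun y => (y.1.1, Fin.cons y.2 y.1.2)
        map_add' := fun y z => by
          ext i
          · rfl
          · refine Fin.cases ?_ (fun i => ?_) i <;> simp
        map_smul' := fun r y => by
          ext i
          · rfl
          · refine Fin.cases ?_ (fun i => ?_) i <;> simp }
    have hLn : ∀ y, ‖y‖ ≤ ‖L y‖ := fun y => by
      have hz : ‖(Fin.cons y.2 y.1.2 : Fin (n + 1) → ℝ)‖ ≤ ‖L y‖ := le_max_right _ _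
      refine max_le (max_le (le_max_left _ _) ?_) ?_
      · refine (pi_norm_le_iff_of_nonneg (norm_nonneg _)).2 fun i => ?_
        exact (norm_le_pi_norm (Fin.cons y.2 y.1.2 : Fin (n + 1) → ℝ) i.succ).trans hz
      · exact (norm_le_pi_norm (Fin.cons y.2 y.1.2 : Fin (n + 1) → ℝ) 0).trans hz
    obtain ⟨G, hG, ⟨c', c'0, hGle⟩, hGI⟩ := exists_convexOn_integral_real (k := n + k) (by omega)
      (h := h ∘ L) (hc.comp_linearMap L) c0
      (fun y => (mul_le_mul_of_nonneg_left (by linarith [hLn y]) c0.le).trans (hle (L y)))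
    obtain ⟨H, hH, hHle, hHI⟩ := ih hk hG c'0 hGle
    refine ⟨H, hH, hHle, fun x => ?_⟩
    rw [← hHI]
    simp only [← hGI]
    have hint : Integrable fun z : Fin (n + 1) → ℝ => (h (x, z) ^ (n + 1 + k))⁻¹ :=
      integrable_inv_pow_of_le (c := c) (hc.continuous_slice x) (by simp; omega) c0 fun w =>
        (mul_le_mul_of_nonneg_left (by gcongr; exact le_max_right _ _) c0.le).trans (hle (x, w))
    have mp := (volume_preserving_piFinSuccAbove (fun _ : Fin (n + 1) => ℝ) 0).symm
    have hi2 := (mp.integrable_comp_emb (MeasurableEquiv.measurableEmbedding _)).2 hint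
    rw [← mp.integral_comp', Measure.volume_eq_prod]
    refine (integral_prod_symm _ hi2).trans ?_
    refine integral_congr_ae (Filter.Eventually.of_forall fun z => ?_)
    refine integral_congr_ae (Filter.Eventually.of_forall fun w => ?_)
    have e : (MeasurableEquiv.piFinSuccAbove (fun _ : Fin (n + 1) => ℝ) 0).symm (w, z) =
        Fin.cons w z := Fin.insertNth_zero' w z
    simp only [Function.comp, e, add_right_comm n 1 k]
    rfl

/-- The linear isomorphism `(τ, z) ↦ (τ, z₁, …, zₙ)`. -/
def euclideanCons (n : ℕ) :
    (ℝ × EuclideanSpace ℝ (Fin n)) ≃ₗ[ℝ] EuclideanSpace ℝ (Fin (n + 1)) where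
  toFun y := WithLp.toLp 2 (Fin.cons y.1 y.2.ofLp)
  invFun y := (y 0, WithLp.toLp 2 fun i => y i.succ)
  map_add' y z := by
    ext i
    refine Fin.cases ?_ (fun i => ?_) i <;> simp
  map_smul' r y := by
    ext i
    refine Fin.cases ?_ (fun i => ?_) i <;> simp
  left_inv y := by ext i <;> simp
  right_inv y := by
    ext i
    refine Fin.cases ?_ (fun i => ?_) i <;> simp

lemma inner_euclideanCons (n : ℕ) (y z : ℝ × EuclideanSpace ℝ (Fin n)) :
    ⟪euclideanCons n y, euclideanCons n z⟫ = y.1 * z.1 + ⟪y.2, z.2⟫ := by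
  rw [PiLp.inner_apply, Fin.sum_univ_succ, PiLp.inner_apply]
  exact congrArg₂ (· + ·) (mul_comm _ _) rfl

lemma exists_volume_eq_smul {E : Type*} [NormedAddCommGroup E] [NormedSpace ℝ E]
    [FiniteDimensional ℝ E] [MeasurableSpace E] [BorelSpace E] (μ ν : Measure E)
    [μ.IsAddHaarMeasure] [ν.IsAddHaarMeasure] :
    ∃ c : ℝ, 0 < c ∧ ∀ s, (μ s).toReal = c * (ν s).toReal := by
  refine ⟨(Measure.addHaarScalarFactor μ ν : ℝ),
    Measure.addHaarScalarFactor_pos_of_isAddHaarMeasure μ ν, fun s => ?_⟩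
  conv_lhs => rw [Measure.isAddLeftInvariant_eq_smul μ ν]
  rw [Measure.smul_apply, ENNReal.smul_def, smul_eq_mul, ENNReal.toReal_mul, ENNReal.coe_toReal]

/-- The radial function of the intersection body is, up to a constant, the volume of an oblique
cylinder of unit height over the central section. -/
lemma exists_radialFn_eq_volume (n : ℕ) :
    ∃ c : ℝ, 0 < c ∧ ∀ (S : Set (EuclideanSpace ℝ (Fin (n + 1)))) (_ : MeasurableSet S)
      (x v : EuclideanSpace ℝ (Fin (n + 1))) (_ : ⟪x, v⟫ = 1),
      radialFn n S x = c * (volume {y | ⟪x, y⟫ ∈ Set.Icc 0 1 ∧ y - ⟪x, y⟫ • v ∈ S}).toReal := by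
  have : (μH[(n : ℝ)] : Measure (EuclideanSpace ℝ (Fin n))).IsAddHaarMeasure := by
    simpa using isAddHaarMeasure_hausdorffMeasure (E := EuclideanSpace ℝ (Fin n))
  let Ψ := (euclideanCons n).toContinuousLinearEquiv
  have hprod : (volume : Measure (ℝ × EuclideanSpace ℝ (Fin n))).IsAddHaarMeasure :=
    inferInstanceAs (Measure.prod volume volume).IsAddHaarMeasure
  have hmap : ((volume : Measure (ℝ × EuclideanSpace ℝ (Fin n))).map Ψ).IsAddHaarMeasure :=
    Ψ.isAddHaarMeasure_map _
  obtain ⟨a, a0, ha⟩ := exists_volume_eq_smul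
    (μH[(n : ℝ)] : Measure (EuclideanSpace ℝ (Fin n))) volume
  obtain ⟨b, b0, hb⟩ := exists_volume_eq_smul
    (volume : Measure (EuclideanSpace ℝ (Fin (n + 1))))
    ((volume : Measure (ℝ × EuclideanSpace ℝ (Fin n))).map Ψ)
  refine ⟨a / b, div_pos a0 b0, fun S hS x v hxv => ?_⟩
  have hx : x ≠ 0 := by rintro rfl; simp at hxv
  have hx0 : 0 < ‖x‖ := norm_pos_iff.2 hx
  have hΨ : ∀ y z, ⟪Ψ y, Ψ z⟫ = y.1 * z.1 + ⟪y.2, z.2⟫ := inner_euclideanCons n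
  set e₀ := Ψ (1, 0) with he₀
  have hn : ‖e₀‖ = ‖‖x‖⁻¹ • x‖ := by
    rw [norm_smul, norm_inv, norm_norm, inv_mul_cancel₀ hx0.ne', norm_eq_sqrt_real_inner, hΨ]
    simp
  let R := (ℝ ∙ (e₀ - ‖x‖⁻¹ • x))ᗮ.reflection
  have hR : R e₀ = ‖x‖⁻¹ • x := Submodule.reflection_sub hn
  have hin : ∀ y, ⟪x, R (Ψ y)⟫ = ‖x‖ * y.1 := fun y => by
    have : x = ‖x‖ • R e₀ := by rw [hR, smul_inv_smul₀ hx0.ne']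
    conv_lhs => rw [this]
    rw [real_inner_smul_left, R.inner_map_map, he₀, hΨ]
    simp
  have hsurj : ∀ y, ∃ z, R (Ψ z) = y := fun y => ⟨Ψ.symm (R.symm y), by simp⟩
  let ι : EuclideanSpace ℝ (Fin n) → EuclideanSpace ℝ (Fin (n + 1)) := fun z => R (Ψ (0, z))
  have hιm : Measurable ι := by fun_prop
  have hι : Isometry ι := by
    refine R.isometry.comp (Isometry.of_dist_eq fun y z => ?_)
    rw [dist_eq_norm, dist_eq_norm, ← map_sub, norm_eq_sqrt_real_inner, hΨ,
      norm_eq_sqrt_real_inner]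
    simp
  have hrange : Set.range ι = perp x := by
    ext y
    constructor
    · rintro ⟨z, rfl⟩
      exact (hin _).trans (by simp)
    · intro hy
      obtain ⟨⟨τ, z⟩, rfl⟩ := hsurj y
      have : ‖x‖ * τ = 0 := (hin _).symm.trans hy
      obtain rfl : τ = 0 := by simpa [hx0.ne'] using this
      exact ⟨z, rfl⟩
  have h1 : (μH[(n : ℝ)] (S ∩ perp x)).toReal = a * (volume (ι ⁻¹' S)).toReal := by
    rw [← hrange, ← hι.hausdorffMeasure_preimage (Or.inl n.cast_nonneg), ha]
  obtain ⟨⟨σ, ζ⟩, hv⟩ := hsurj v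
  have hσ : ‖x‖ * σ = 1 := by rw [← hxv, ← hv, hin]
  have hA : MeasurableSet {y | ⟪x, y⟫ ∈ Set.Icc 0 1 ∧ y - ⟪x, y⟫ • v ∈ S} :=
    ((by fun_prop : Measurable fun y => ⟪x, y⟫) measurableSet_Icc).inter
      ((by fun_prop : Measurable fun y => y - ⟪x, y⟫ • v) hS)
  have hpre : Ψ ⁻¹' (R ⁻¹' {y | ⟪x, y⟫ ∈ Set.Icc 0 1 ∧ y - ⟪x, y⟫ • v ∈ S}) =
      {y | y.1 ∈ Set.Icc 0 ‖x‖⁻¹ ∧ y.2 - (‖x‖ * y.1) • ζ ∈ ι ⁻¹' S} := by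
    ext ⟨τ, z⟩
    simp only [Set.mem_preimage, Set.mem_ofPred_eq, hin]
    refine and_congr ?_ ?_
    · rw [Set.mem_Icc, Set.mem_Icc, mul_nonneg_iff_of_pos_left hx0, ← le_div_iff₀' hx0,
        one_div]
    · have : R (Ψ (τ, z)) - (‖x‖ * τ) • v = ι (z - (‖x‖ * τ) • ζ) := by
        simp only [ι]
        rw [← hv, ← map_smul, ← map_smul, ← map_sub, ← map_sub]
        congr 2
        ext1
        · simp only [Prod.smul_mk, Prod.mk_sub_mk, smul_eq_mul]
          linear_combination (-τ) * hσ
        · simp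
      rw [this]
  have h2 : volume {y : ℝ × EuclideanSpace ℝ (Fin n) |
      y.1 ∈ Set.Icc 0 ‖x‖⁻¹ ∧ y.2 - (‖x‖ * y.1) • ζ ∈ ι ⁻¹' S} =
      ENNReal.ofReal ‖x‖⁻¹ * volume (ι ⁻¹' S) := by
    rw [Measure.volume_eq_prod, Measure.prod_apply]
    · have : ∀ τ : ℝ, volume (Prod.mk τ ⁻¹' {y : ℝ × EuclideanSpace ℝ (Fin n) |
          y.1 ∈ Set.Icc 0 ‖x‖⁻¹ ∧ y.2 - (‖x‖ * y.1) • ζ ∈ ι ⁻¹' S}) =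
          (Set.Icc 0 ‖x‖⁻¹).indicator (fun _ => volume (ι ⁻¹' S)) τ := fun τ => by
        by_cases hτ : τ ∈ Set.Icc 0 ‖x‖⁻¹
        · rw [Set.indicator_of_mem hτ,
            ← measure_preimage_add_right volume (-((‖x‖ * τ) • ζ)) (ι ⁻¹' S)]
          congr 1
          ext z
          refine ⟨fun h => ?_, fun h => ⟨hτ, ?_⟩⟩
          · have := h.2
            rwa [sub_eq_add_neg] at this
          · rwa [sub_eq_add_neg]
        · rw [Set.indicator_of_notMem hτ]
          refine measure_mono_null (fun z h => hτ h.1) measure_empty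
      simp only [this]
      rw [lintegral_indicator measurableSet_Icc, setLIntegral_const, Real.volume_Icc, sub_zero,
        mul_comm]
    · exact (measurable_fst measurableSet_Icc).inter
        ((by fun_prop : Measurable fun y : ℝ × EuclideanSpace ℝ (Fin n) =>
          y.2 - (‖x‖ * y.1) • ζ) (hιm hS))
  rw [radialFn, h1, ← R.measurePreserving.measure_preimage hA.nullMeasurableSet, hb,
    Measure.map_apply Ψ.continuous.measurable (R.continuous.measurable hA), hpre, h2,
    ENNReal.toReal_mul, ENNReal.toReal_ofReal (by positivity)]
  field_simp

lemma lintegral_abs_pow_indicator (n : ℕ) {r : ℝ} (hr : 0 ≤ r) :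
    ∫⁻ s : ℝ, Set.indicator {s | |s| ≤ r} (fun s => ENNReal.ofReal (|s| ^ n)) s =
      ENNReal.ofReal (2 / (n + 1) * r ^ (n + 1)) := by
  have hs : {s : ℝ | |s| ≤ r} = Set.Icc (-r) r := by
    ext s; exact abs_le (a := s)
  have hc : Continuous fun s : ℝ => |s| ^ n := by fun_prop
  rw [hs, lintegral_indicator measurableSet_Icc, ← ofReal_integral_eq_lintegral_ofReal
    (hc.integrableOn_Icc) (Filter.Eventually.of_forall fun s => by positivity),
    integral_Icc_eq_integral_Ioc, ← intervalIntegral.integral_of_le (by linarith),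
    ← intervalIntegral.integral_add_adjacent_intervals (b := 0) (hc.intervalIntegrable _ _)
      (hc.intervalIntegrable _ _)]
  have h1 : ∫ s in (0 : ℝ)..r, |s| ^ n = r ^ (n + 1) / (n + 1) := by
    rw [intervalIntegral.integral_congr (g := fun s => s ^ n), integral_pow]
    · simp
    · intro s hs
      rw [Set.uIcc_of_le hr] at hs
      simp only [abs_of_nonneg hs.1]
  have h2 : ∫ s in (-r)..0, |s| ^ n = ∫ s in (0 : ℝ)..r, |s| ^ n := by
    rw [← neg_zero, ← intervalIntegral.integral_comp_neg]
    simp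
  rw [h2, h1]
  congr 1
  ring

/-- Volume of a set that is, in projective coordinates `(s, z) ↦ (s, s • z)`, the region
`|s| * f z ≤ 1`. -/
lemma volume_eq_lintegral_of_projective (n : ℕ) {A : Set (ℝ × (Fin n → ℝ))}
    (hA : MeasurableSet A) {f : (Fin n → ℝ) → ℝ} (hf : Measurable f) (hf0 : ∀ z, 0 < f z)
    (hAf : ∀ s z, s ≠ 0 → ((s, s • z) ∈ A ↔ |s| * f z ≤ 1)) :
    volume A = ∫⁻ z, ENNReal.ofReal (2 / (n + 1) * (f z ^ (n + 1))⁻¹) := by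
  have hB : MeasurableSet {y : ℝ × (Fin n → ℝ) | |y.1| * f y.2 ≤ 1} :=
    measurableSet_le (by fun_prop) measurable_const
  rw [Measure.volume_eq_prod, Measure.prod_apply hA]
  have h1 : ∀ᵐ s : ℝ, volume (Prod.mk s ⁻¹' A) = ∫⁻ z : Fin n → ℝ,
      Set.indicator {y : ℝ × (Fin n → ℝ) | |y.1| * f y.2 ≤ 1}
        (fun y => ENNReal.ofReal (|y.1| ^ n)) (s, z) := by
    filter_upwards [Measure.ae_ne volume (0 : ℝ)] with s hs
    have h2 := Measure.addHaar_preimage_smul (volume : Measure (Fin n → ℝ)) hs (Prod.mk s ⁻¹' A)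
    have h3 : (fun z : Fin n → ℝ => s • z) ⁻¹' (Prod.mk s ⁻¹' A) = {z | |s| * f z ≤ 1} := by
      ext z; exact hAf s z hs
    rw [h3, Module.finrank_fin_fun, abs_inv, abs_pow] at h2
    have h4 : volume (Prod.mk s ⁻¹' A) =
        ENNReal.ofReal (|s| ^ n) * volume {z | |s| * f z ≤ 1} := by
      rw [h2, ← mul_assoc, ← ENNReal.ofReal_mul (by positivity), mul_inv_cancel₀ (by positivity),
        ENNReal.ofReal_one, one_mul]
    rw [h4, ← setLIntegral_const,
      ← lintegral_indicator (measurableSet_le (by fun_prop) measurable_const)]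
    rfl
  rw [lintegral_congr_ae h1, lintegral_lintegral_swap]
  · refine lintegral_congr fun z => ?_
    rw [← inv_pow, ← lintegral_abs_pow_indicator n (inv_nonneg.2 (hf0 z).le)]
    refine lintegral_congr fun s => ?_
    simp only [Set.indicator, Set.mem_ofPred_eq, ← one_div, le_div_iff₀ (hf0 z)]
  · exact ((by fun_prop : Measurable fun y : ℝ × (Fin n → ℝ) =>
      ENNReal.ofReal (|y.1| ^ n)).indicator hB).aemeasurable

open Module in
/-- Busemann's theorem along a line that misses the origin, for the unit ball of a norm. -/
lemma exists_radialFn_lineMap_eq {n : ℕ} {G : Type*} [NormedAddCommGroup G] [NormedSpace ℝ G]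
    (D : EuclideanSpace ℝ (Fin (n + 2)) ≃L[ℝ] G) {x₀ x₁ : EuclideanSpace ℝ (Fin (n + 2))}
    (hx₀ : x₀ ≠ 0) (hx : ∀ r : ℝ, x₁ ≠ r • x₀) :
    ∃ (C : ℝ) (H : ℝ → ℝ), 0 < C ∧ (∀ t, 0 < H t) ∧ ConvexOn ℝ Set.univ H ∧
      ∀ t, radialFn ((n + 1 : ℕ) : ℝ) {y | ‖D y‖ ≤ 1} ((1 - t) • x₀ + t • x₁) = C / H t := by
  obtain ⟨c, c0, hc⟩ := exists_radialFn_eq_volume (n + 1)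
  set A := ⟪x₀, x₀⟫ with hA
  set B := ⟪x₀, x₁⟫ with hB
  set C := ⟪x₁, x₁⟫ with hC
  have hB' : ⟪x₁, x₀⟫ = B := real_inner_comm _ _
  have hA0 : A ≠ 0 := by simpa [hA] using hx₀
  have hΔ : A * C - B * B ≠ 0 := fun h => by
    have h1 : A • x₁ - B • x₀ = 0 := by
      rw [← inner_self_eq_zero (𝕜 := ℝ)]
      simp only [inner_sub_left, inner_sub_right, real_inner_smul_left, real_inner_smul_right,
        ← hA, ← hB, ← hC, hB']
      linear_combination A * h
    refine hx (B / A) ?_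
    rw [div_eq_inv_mul, mul_smul, ← sub_eq_zero.1 h1, inv_smul_smul₀ hA0]
  set Δ := A * C - B * B with hΔdef
  let p := Δ⁻¹ • (A • x₁ - B • x₀)
  let q := Δ⁻¹ • (C • x₀ - B • x₁)
  have hp₀ : ⟪x₀, p⟫ = 0 := by
    simp only [p, inner_sub_right, real_inner_smul_right, ← hA, ← hB]; ring
  have hp₁ : ⟪x₁, p⟫ = 1 := by
    simp only [p, inner_sub_right, real_inner_smul_right, ← hC, hB']; field_simp; rw [hΔdef]; ring
  have hq₀ : ⟪x₀, q⟫ = 1 := by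
    simp only [q, inner_sub_right, real_inner_smul_right, ← hA, ← hB]; field_simp; rw [hΔdef]; ring
  have hq₁ : ⟪x₁, q⟫ = 0 := by
    simp only [q, inner_sub_right, real_inner_smul_right, ← hC, hB']; ring
  let Λ : EuclideanSpace ℝ (Fin (n + 2)) →ₗ[ℝ] ℝ × ℝ :=
    (innerₛₗ ℝ x₀).prod (innerₛₗ ℝ x₁)
  have hΛ : ∀ y, Λ y = (⟪x₀, y⟫, ⟪x₁, y⟫) := fun y => rfl
  have hrange : LinearMap.range Λ = ⊤ := by
    refine LinearMap.range_eq_top.2 fun y => ⟨y.1 • q + y.2 • p, ?_⟩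
    simp [hΛ, inner_add_right, real_inner_smul_right, hp₀, hp₁, hq₀, hq₁]
  have hker : finrank ℝ (LinearMap.ker Λ) = finrank ℝ (Fin n → ℝ) := by
    have := LinearMap.finrank_range_add_finrank_ker Λ
    rw [hrange, finrank_top] at this
    simp at this ⊢
    omega
  let K : (Fin n → ℝ) ≃ₗ[ℝ] LinearMap.ker Λ := LinearEquiv.ofFinrankEq _ _ hker.symm
  have hK : ∀ z, ⟪x₀, (K z : EuclideanSpace ℝ (Fin (n + 2)))⟫ = 0 ∧
      ⟪x₁, (K z : EuclideanSpace ℝ (Fin (n + 2)))⟫ = 0 := fun z => by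
    have := LinearMap.mem_ker.1 (K z).2
    rwa [hΛ, Prod.mk_eq_zero] at this
  let v := p + q
  have hv₀ : ⟪x₀, v⟫ = 1 := by simp [v, inner_add_right, hp₀, hq₀]
  have hv₁ : ⟪x₁, v⟫ = 1 := by simp [v, inner_add_right, hp₁, hq₁]
  let Ξ' : (ℝ × (ℝ × (Fin n → ℝ))) →ₗ[ℝ] EuclideanSpace ℝ (Fin (n + 2)) :=
    (LinearMap.toSpanSingleton ℝ _ v).coprod ((LinearMap.toSpanSingleton ℝ _ p).coprod
      ((LinearMap.ker Λ).subtype ∘ₗ K.toLinearMap))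
  have hΞ' : ∀ β s z, Ξ' (β, s, z) = β • v + (s • p + K z) := fun β s z => rfl
  have hinj : Function.Injective Ξ' := by
    refine (injective_iff_map_eq_zero Ξ').2 fun ⟨β, s, z⟩ h => ?_
    rw [hΞ'] at h
    have h0 := congrArg (fun y => ⟪x₀, y⟫) h
    have h1 := congrArg (fun y => ⟪x₁, y⟫) h
    simp only [inner_add_right, real_inner_smul_right, hp₀, hp₁, hv₀, hv₁, (hK z).1, (hK z).2,
      inner_zero_right] at h0 h1
    obtain rfl : β = 0 := by linarith
    obtain rfl : s = 0 := by linarith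
    have : z = 0 := by simpa using h
    rw [this]; rfl
  let Ξ : (ℝ × (ℝ × (Fin n → ℝ))) ≃L[ℝ] EuclideanSpace ℝ (Fin (n + 2)) :=
    (LinearMap.linearEquivOfInjective Ξ' hinj (by simp; ring)).toContinuousLinearEquiv
  have hΞ : ∀ β s z, Ξ (β, s, z) = β • v + (s • p + K z) := hΞ'
  have hprod : (volume : Measure (ℝ × (Fin n → ℝ))).IsAddHaarMeasure :=
    inferInstanceAs (Measure.prod volume volume).IsAddHaarMeasure
  have hprod' : (volume : Measure (ℝ × (ℝ × (Fin n → ℝ)))).IsAddHaarMeasure :=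
    inferInstanceAs (Measure.prod volume volume).IsAddHaarMeasure
  have hmap : ((volume : Measure (ℝ × (ℝ × (Fin n → ℝ)))).map Ξ).IsAddHaarMeasure :=
    Ξ.isAddHaarMeasure_map _
  obtain ⟨κ, κ0, hκ⟩ := exists_volume_eq_smul
    (volume : Measure (EuclideanSpace ℝ (Fin (n + 2))))
    ((volume : Measure (ℝ × (ℝ × (Fin n → ℝ)))).map Ξ)
  let N := Ξ.trans D
  let h : ℝ × (Fin n → ℝ) → ℝ := fun y => ‖N (-y.1, 1, y.2)‖
  have hconv : ConvexOn ℝ Set.univ h := by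
    refine ⟨convex_univ, fun y _ z _ a b ha hb hab => ?_⟩
    have e : ((-(a • y + b • z).1, 1, (a • y + b • z).2) : ℝ × (ℝ × (Fin n → ℝ))) =
        a • (-y.1, 1, y.2) + b • (-z.1, 1, z.2) := by
      ext
      · simp; ring
      · simp [hab]
      · simp
    simp only [h]
    rw [e, map_add, map_smul, map_smul]
    refine (norm_add_le _ _).trans ?_
    rw [norm_smul, norm_smul, Real.norm_of_nonneg ha, Real.norm_of_nonneg hb]
    rfl
  set M := ‖(N.symm : G →L[ℝ] (ℝ × (ℝ × (Fin n → ℝ))))‖ with hM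
  have hle : ∀ y, (2 * (M + 1))⁻¹ * (1 + ‖y‖) ≤ h y := fun y => by
    have h1 : ‖((-y.1, 1, y.2) : ℝ × (ℝ × (Fin n → ℝ)))‖ ≤ M * h y := by
      have := (N.symm : G →L[ℝ] (ℝ × (ℝ × (Fin n → ℝ)))).le_opNorm (N (-y.1, 1, y.2))
      simpa only [ContinuousLinearEquiv.coe_coe, ContinuousLinearEquiv.symm_apply_apply] using this
    have h2 : ‖y.1‖ ≤ ‖((-y.1, 1, y.2) : ℝ × (ℝ × (Fin n → ℝ)))‖ := by
      rw [← norm_neg]; exact le_max_left _ _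
    have h3 : ‖((1, y.2) : ℝ × (Fin n → ℝ))‖ ≤ ‖((-y.1, 1, y.2) : ℝ × (ℝ × (Fin n → ℝ)))‖ :=
      le_max_right _ _
    have h4 : (1 : ℝ) ≤ ‖((1, y.2) : ℝ × (Fin n → ℝ))‖ := by
      simp
    have h5 : ‖y.2‖ ≤ ‖((1, y.2) : ℝ × (Fin n → ℝ))‖ := le_max_right _ _
    have h6 : ‖y‖ ≤ M * h y := max_le (h2.trans h1) ((h5.trans h3).trans h1)
    have h7 : 0 ≤ h y := norm_nonneg _
    have h8 : 0 ≤ M := norm_nonneg _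
    rw [inv_mul_le_iff₀ (by positivity)]
    linarith
  have hM0 : 0 < (2 * (M + 1))⁻¹ := by
    have : 0 ≤ M := norm_nonneg _
    positivity
  have hpos : ∀ y, 0 < h y := fun y => lt_of_lt_of_le (by positivity) (hle y)
  obtain ⟨H, hH, ⟨c', c'0, hHle⟩, hHI⟩ := exists_convexOn_integral_pi n le_rfl hconv hM0 hle
  refine ⟨c * κ * (2 / (n + 1)), H, by positivity,
    fun t => lt_of_lt_of_le (by positivity) (hHle t), hH, fun t => ?_⟩
  have hP : MeasurableSet {y | ‖D y‖ ≤ 1} :=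
    (isClosed_le (by fun_prop) continuous_const).measurableSet
  have hxt : ∀ β s z, ⟪(1 - t) • x₀ + t • x₁, Ξ (β, s, z)⟫ = β + t * s := fun β s z => by
    simp only [hΞ, inner_add_left, inner_add_right, real_inner_smul_left, real_inner_smul_right,
      hp₀, hp₁, hv₀, hv₁, (hK z).1, (hK z).2]
    ring
  have hxv : ⟪(1 - t) • x₀ + t • x₁, v⟫ = 1 := by
    simp only [inner_add_left, real_inner_smul_left, hv₀, hv₁]
    ring
  set x := (1 - t) • x₀ + t • x₁ with hxdef
  have hS : MeasurableSet {y | ⟪x, y⟫ ∈ Set.Icc 0 1 ∧ y - ⟪x, y⟫ • v ∈ {y | ‖D y‖ ≤ 1}} :=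
    ((by fun_prop : Measurable fun y => ⟪x, y⟫) measurableSet_Icc).inter
      ((by fun_prop : Measurable fun y => y - ⟪x, y⟫ • v) hP)
  let S : Set (ℝ × (Fin n → ℝ)) := {y | ‖N (-(t * y.1), y.1, y.2)‖ ≤ 1}
  have hSm : MeasurableSet S := (isClosed_le (by fun_prop) continuous_const).measurableSet
  have hpre : Ξ ⁻¹' {y | ⟪x, y⟫ ∈ Set.Icc 0 1 ∧ y - ⟪x, y⟫ • v ∈ {y | ‖D y‖ ≤ 1}} =
      {y | y.1 + t * y.2.1 ∈ Set.Icc 0 1 ∧ y.2 ∈ S} := by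
    ext ⟨β, s, z⟩
    have e : Ξ (β, s, z) - (β + t * s) • v = Ξ (-(t * s), s, z) := by
      rw [hΞ, hΞ]; module
    simp only [Set.mem_preimage, Set.mem_ofPred_eq, hxt, e]
    rfl
  have hvol : volume {y : ℝ × (ℝ × (Fin n → ℝ)) | y.1 + t * y.2.1 ∈ Set.Icc 0 1 ∧ y.2 ∈ S} =
      volume S := by
    rw [Measure.volume_eq_prod, Measure.prod_apply_symm, ← lintegral_indicator_one hSm]
    · refine lintegral_congr fun y => ?_
      by_cases hy : y ∈ S
      · have : (fun β : ℝ => (β, y)) ⁻¹' {y : ℝ × (ℝ × (Fin n → ℝ)) |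
            y.1 + t * y.2.1 ∈ Set.Icc 0 1 ∧ y.2 ∈ S} =
            (fun β => β + t * y.1) ⁻¹' Set.Icc 0 1 := by
          ext β
          exact and_iff_left hy
        rw [this, measure_preimage_add_right, Set.indicator_of_mem hy]
        simp
      · rw [Set.indicator_of_notMem hy]
        exact measure_mono_null (fun β h => hy h.2) measure_empty
    · exact ((by fun_prop : Measurable fun y : ℝ × (ℝ × (Fin n → ℝ)) =>
        y.1 + t * y.2.1) measurableSet_Icc).inter (measurable_snd hSm)
  have hcont := hconv.continuous_slice t
  have hproj := volume_eq_lintegral_of_projective n hSm (f := fun z => h (t, z)) hcont.measurable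
    (fun z => hpos _) fun s z _ => by
      have e : ((-(t * s), s, s • z) : ℝ × (ℝ × (Fin n → ℝ))) = s • (-t, 1, z) := by
        ext <;> simp [mul_comm]
      simp only [S, h, Set.mem_ofPred_eq, e, map_smul, norm_smul, Real.norm_eq_abs]
  have hint : ∫ z, 2 / ((n : ℝ) + 1) * (h (t, z) ^ (n + 1))⁻¹ = 2 / (n + 1) * (H t)⁻¹ := by
    rw [integral_const_mul, hHI, pow_one]
  have hnn : ∀ z, 0 ≤ 2 / ((n : ℝ) + 1) * (h (t, z) ^ (n + 1))⁻¹ := fun z => by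
    have := hpos (t, z)
    positivity
  rw [integral_eq_lintegral_of_nonneg_ae (Filter.Eventually.of_forall hnn)
    (((hcont.pow _).inv₀ fun z => (pow_pos (hpos _) _).ne').const_smul
      (2 / ((n : ℝ) + 1))).aestronglyMeasurable] at hint
  rw [hc _ hP x v hxv, hκ, Measure.map_apply Ξ.continuous.measurable hS, hpre, hvol, hproj, hint]
  ring

lemma radialFn_smul {d : ℕ} (s : ℝ) (P : Set (EuclideanSpace ℝ (Fin d))) {r : ℝ} (hr : r ≠ 0)
    (x : EuclideanSpace ℝ (Fin d)) : radialFn s P (r • x) = radialFn s P x / |r| := by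
  have h : perp (r • x) = perp x := by
    ext y
    simp [perp, real_inner_smul_left, hr]
  rw [radialFn, radialFn, h, norm_smul, Real.norm_eq_abs, mul_comm, div_div]

lemma smul_mem_ibody {d : ℕ} {s : ℝ} {P : Set (EuclideanSpace ℝ (Fin d))} {r : ℝ}
    {x : EuclideanSpace ℝ (Fin d)} (hr : |r| ≤ 1) (hx : x ∈ ibody s P) : r • x ∈ ibody s P := by
  by_cases h0 : r • x = 0
  · exact Or.inl h0
  obtain ⟨hr0, hx0⟩ := smul_ne_zero_iff.1 h0
  obtain hx | hx := hx
  · exact absurd hx hx0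
  · refine Or.inr ⟨h0, ?_⟩
    rw [radialFn_smul s P hr0, le_div_iff₀ (abs_pos.2 hr0), one_mul]
    exact hr.trans hx.2

/-- Busemann's theorem for the unit ball of a norm. -/
lemma convex_ibody_of_equiv {n : ℕ} {G : Type*} [NormedAddCommGroup G] [NormedSpace ℝ G]
    (D : EuclideanSpace ℝ (Fin (n + 2)) ≃L[ℝ] G) :
    Convex ℝ (ibody ((n + 1 : ℕ) : ℝ) {y | ‖D y‖ ≤ 1}) := by
  intro x₀ h₀ x₁ h₁ a b ha hb hab
  by_cases hx₀ : x₀ = 0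
  · rw [hx₀, smul_zero, zero_add]
    exact smul_mem_ibody (by rw [abs_of_nonneg hb]; linarith) h₁
  by_cases hx : ∃ r : ℝ, x₁ = r • x₀
  · obtain ⟨r, rfl⟩ := hx
    rw [smul_smul, ← add_smul]
    rcases le_total |r| 1 with hr | hr
    · refine smul_mem_ibody ?_ h₀
      calc |a + b * r| ≤ |a| + |b * r| := abs_add_le _ _
        _ = a + b * |r| := by rw [abs_mul, abs_of_nonneg ha, abs_of_nonneg hb]
        _ ≤ 1 := by nlinarith
    · have hr0 : r ≠ 0 := by rintro rfl; norm_num at hr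
      have := smul_mem_ibody (r := (a + b * r) / r) ?_ h₁
      · rwa [smul_smul, div_mul_cancel₀ _ hr0] at this
      rw [abs_div, div_le_one (by positivity)]
      calc |a + b * r| ≤ |a| + |b * r| := abs_add_le _ _
        _ = a + b * |r| := by rw [abs_mul, abs_of_nonneg ha, abs_of_nonneg hb]
        _ ≤ |r| := by nlinarith
  push Not at hx
  obtain ⟨C, H, hC, hH, hconv, h⟩ := exists_radialFn_lineMap_eq D hx₀ hx
  have hx₁ : x₁ ≠ 0 := by simpa using hx 0
  have e₀ := h 0
  have e₁ := h 1
  have e := h b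
  simp only [sub_zero, one_smul, zero_smul, add_zero, sub_self, zero_add] at e₀ e₁
  rw [show 1 - b = a by linarith] at e
  have g₀ := (h₀.resolve_left hx₀).2
  have g₁ := (h₁.resolve_left hx₁).2
  rw [e₀, le_div_iff₀ (hH 0), one_mul] at g₀
  rw [e₁, le_div_iff₀ (hH 1), one_mul] at g₁
  refine Or.inr ⟨fun h0 => ?_, ?_⟩
  · have hb0 : b ≠ 0 := by
      rintro rfl
      rw [zero_smul, add_zero, show a = 1 by linarith, one_smul] at h0
      exact hx₀ h0
    refine hx (-(a / b)) ?_
    have : b • x₁ = -(a • x₀) := eq_neg_of_add_eq_zero_right h0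
    rw [neg_smul, div_eq_inv_mul, mul_smul, ← smul_neg, ← this, inv_smul_smul₀ hb0]
  · rw [e, le_div_iff₀ (hH b), one_mul]
    have := hconv.2 (Set.mem_univ 0) (Set.mem_univ 1) ha hb hab
    simp only [smul_eq_mul, mul_zero, mul_one, zero_add] at this
    nlinarith

lemma convex_ibody_of_symmetric {n : ℕ} {b : Fin (n + 2) → ℝ} (hb : ∀ i, 0 < b i) :
    Convex ℝ (ibody ((n + 1 : ℕ) : ℝ)
      {x : EuclideanSpace ℝ (Fin (n + 2)) | ∀ i, x i ∈ Set.Icc (-b i) (b i)}) := by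
  let D : EuclideanSpace ℝ (Fin (n + 2)) ≃L[ℝ] (Fin (n + 2) → ℝ) :=
    (EuclideanSpace.equiv (Fin (n + 2)) ℝ).trans
      (ContinuousLinearEquiv.piCongrRight fun i =>
        ContinuousLinearEquiv.unitsEquivAut ℝ (Units.mk0 (b i)⁻¹ (inv_pos.2 (hb i)).ne'))
  have hD : ∀ y i, D y i = y i * (b i)⁻¹ := fun y i => rfl
  convert convex_ibody_of_equiv D using 2
  ext y
  simp only [Set.mem_ofPred_eq]
  rw [pi_norm_le_iff_of_nonneg zero_le_one]
  refine forall_congr' fun i => ?_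
  rw [hD, Real.norm_eq_abs, abs_mul, abs_inv, abs_of_pos (hb i), ← div_eq_mul_inv,
    div_le_one (hb i), abs_le, Set.mem_Icc]

/-- The length of the section of `[a₁, b₁] × [a₂, b₂]` by the line orthogonal to `(1, s)`,
measured along the second coordinate. -/
def sliceLength (a₁ b₁ a₂ b₂ s : ℝ) : ℝ :=
  (volume (Set.Icc a₂ b₂ ∩ {y | -s * y ∈ Set.Icc a₁ b₁})).toReal

/-- Convexity of the region of the plane with radial function `|α| * φ s` in the
direction of `(α, α * s)`, expressed through `φ`. -/
def ProjectivelyConvex (φ : ℝ → ℝ) : Prop :=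
  ∀ s₀ s₁ α β r : ℝ, 0 < φ s₀ → 0 < φ s₁ → α + β ≠ 0 → α * s₀ + β * s₁ = (α + β) * r →
    0 < φ r ∧ |α + β| / φ r ≤ |α| / φ s₀ + |β| / φ s₁

lemma ProjectivelyConvex.comp_neg {φ : ℝ → ℝ} (h : ProjectivelyConvex φ) :
    ProjectivelyConvex fun s => φ (-s) := fun s₀ s₁ α β r h₀ h₁ hαβ hr =>
  h _ _ α β (-r) h₀ h₁ hαβ (by linear_combination -hr)

lemma sliceLength_neg_left (a₁ b₁ a₂ b₂ s : ℝ) :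
    sliceLength (-b₁) (-a₁) a₂ b₂ s = sliceLength a₁ b₁ a₂ b₂ (-s) := by
  unfold sliceLength
  congr 3
  ext y
  simp only [Set.mem_ofPred_eq, Set.mem_Icc]
  constructor <;> rintro ⟨h1, h2⟩ <;> constructor <;> linarith

lemma sliceLength_neg_right (a₁ b₁ a₂ b₂ s : ℝ) :
    sliceLength a₁ b₁ (-b₂) (-a₂) s = sliceLength a₁ b₁ a₂ b₂ (-s) := by
  unfold sliceLength
  rw [← Measure.measure_neg]
  congr 2
  ext y
  simp only [Set.mem_neg, Set.mem_inter_iff, Set.mem_ofPred_eq, Set.mem_Icc]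
  constructor <;> rintro ⟨⟨h1, h2⟩, h3, h4⟩ <;> refine ⟨⟨?_, ?_⟩, ?_, ?_⟩ <;> linarith

lemma exists_ne_zero_of_sliceLength_pos {a₁ b₁ a₂ b₂ s : ℝ}
    (h : 0 < sliceLength a₁ b₁ a₂ b₂ s) :
    ∃ y ≠ 0, y ∈ Set.Icc a₂ b₂ ∧ -s * y ∈ Set.Icc a₁ b₁ := by
  by_contra! hc
  refine h.ne' ?_
  have : volume (Set.Icc a₂ b₂ ∩ {y | -s * y ∈ Set.Icc a₁ b₁}) = 0 :=
    measure_mono_null (t := {0}) (fun y hy => by_contra fun h0 => hc y h0 hy.1 hy.2)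
      Real.volume_singleton
  rw [sliceLength, this, ENNReal.toReal_zero]

lemma sliceLength_pos_of_projectivelyConvex {a₁ b₁ a₂ b₂ : ℝ} (h₁ : a₁ < b₁) (h₂ : a₂ < b₂)
    (h : ProjectivelyConvex (sliceLength a₁ b₁ a₂ b₂)) (r : ℝ) :
    0 < sliceLength a₁ b₁ a₂ b₂ r := by
  obtain ⟨y, hy, hy0⟩ := (Set.Ioo_infinite h₂).exists_notMem_finset {0}
  rw [Finset.mem_singleton] at hy0
  have key : ∀ m ∈ Set.Ioo a₁ b₁, 0 < sliceLength a₁ b₁ a₂ b₂ (-(m / y)) := fun m hm => by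
    have hU : IsOpen (Set.Ioo a₂ b₂ ∩ {z | - -(m / y) * z ∈ Set.Ioo a₁ b₁}) :=
      isOpen_Ioo.inter (isOpen_Ioo.preimage (by fun_prop : Continuous fun z => - -(m / y) * z))
    refine ENNReal.toReal_pos (ne_of_gt ((hU.measure_pos volume ⟨y, hy, ?_⟩).trans_le
      (measure_mono (Set.inter_subset_inter Set.Ioo_subset_Icc_self
        fun z hz => Set.Ioo_subset_Icc_self hz))))
      (measure_ne_top_of_subset Set.inter_subset_left measure_Icc_lt_top.ne)
    simpa [hy0] using hm
  obtain ⟨m, hm⟩ := exists_between h₁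
  obtain ⟨m', hm'⟩ := exists_between hm.2
  have hne : m' - m ≠ 0 := (sub_pos.2 hm'.1).ne'
  refine (h _ _ (1 + (r * y + m) / (m' - m)) (-((r * y + m) / (m' - m))) r (key m hm)
    (key m' ⟨hm.1.trans hm'.1, hm'.2⟩) (by simp) ?_).1
  field_simp
  ring

lemma mul_le_mul_of_projectivelyConvex {a₁ b₁ a₂ b₂ : ℝ} (ha₁ : a₁ ≤ 0)
    (ha₂ : a₂ < 0) (hb₂ : 0 < b₂) (h : ProjectivelyConvex (sliceLength a₁ b₁ a₂ b₂)) :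
    b₁ * -a₂ ≤ -a₁ * b₂ := by
  by_contra! hlt
  obtain ⟨p, hp⟩ : ∃ p, a₁ = p * a₂ := ⟨a₁ / a₂, (div_mul_cancel₀ _ ha₂.ne).symm⟩
  obtain ⟨δ, hδ⟩ : ∃ δ, b₁ = (p + 2 * δ) * b₂ :=
    ⟨(b₁ / b₂ - p) / 2, by field_simp; ring⟩
  subst hp hδ
  have hp0 : 0 ≤ p := by nlinarith
  have hδ0 : 0 < δ := by
    have : 0 < δ * (b₂ * -a₂) := by nlinarith
    exact pos_of_mul_pos_left this (by nlinarith)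
  have hX : 0 < b₂ - a₂ := by linarith
  have vol : ∀ σ l, l ≤ b₂ → (∀ y, (y ∈ Set.Icc a₂ b₂ ∧
      - -σ * y ∈ Set.Icc (p * a₂) ((p + 2 * δ) * b₂)) ↔ y ∈ Set.Icc l b₂) →
      sliceLength (p * a₂) ((p + 2 * δ) * b₂) a₂ b₂ (-σ) = b₂ - l := fun σ l hl hs => by
    rw [sliceLength, show Set.Icc a₂ b₂ ∩ {y | - -σ * y ∈ Set.Icc (p * a₂) ((p + 2 * δ) * b₂)} =
      Set.Icc l b₂ from Set.ext hs, Real.volume_Icc, ENNReal.toReal_ofReal (by linarith)]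
  have volp : sliceLength (p * a₂) ((p + 2 * δ) * b₂) a₂ b₂ (-p) = b₂ - a₂ := by
    refine vol p a₂ (by linarith) fun y => ⟨fun hy => hy.1, fun hy => ⟨hy, ?_, ?_⟩⟩
    · rw [neg_neg]; exact mul_le_mul_of_nonneg_left hy.1 hp0
    · rw [neg_neg]
      nlinarith [mul_le_mul_of_nonneg_left hy.2 hp0, mul_pos hδ0 hb₂]
  have volσ : ∀ σ, p ≤ σ → σ ≤ p + 2 * δ → 0 < σ →
      sliceLength (p * a₂) ((p + 2 * δ) * b₂) a₂ b₂ (-σ) = (σ * b₂ - p * a₂) / σ :=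
    fun σ h1 h2 h3 => by
    have hl : p * a₂ / σ ≤ 0 := div_nonpos_of_nonpos_of_nonneg (by nlinarith) h3.le
    rw [vol σ (p * a₂ / σ) (by linarith) fun y => ?_]
    · field_simp
    · simp only [Set.mem_Icc, neg_neg, div_le_iff₀' h3]
      refine ⟨fun hy => ⟨hy.2.1, hy.1.2⟩, fun hy => ⟨⟨?_, hy.2⟩, hy.1, ?_⟩⟩
      · have : σ * a₂ ≤ p * a₂ := by nlinarith
        exact le_of_mul_le_mul_left (this.trans hy.1) h3
      · nlinarith [mul_le_mul_of_nonneg_left hy.2 h3.le]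
  have volq := volσ (p + 2 * δ) (by linarith) le_rfl (by linarith)
  have volm := volσ (p + δ) (by linarith) (by linarith) (by linarith)
  have hpa : 0 ≤ -(p * a₂) := by linarith
  have hq : 0 < (p + 2 * δ) * b₂ - p * a₂ := by
    have : 0 < (p + 2 * δ) * b₂ := by positivity
    linarith
  have hm : 0 < (p + δ) * b₂ - p * a₂ := by
    have : 0 < (p + δ) * b₂ := by positivity
    linarith
  have hQ := (h (-p) (-(p + 2 * δ)) 1 1 (-(p + δ)) (by rw [volp]; exact hX)
    (by rw [volq]; positivity) (by norm_num) (by ring)).2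
  rw [volp, volq, volm, div_div_eq_mul_div, div_div_eq_mul_div, div_add_div _ _ hX.ne' hq.ne',
    div_le_div_iff₀ hm (by positivity)] at hQ
  norm_num at hQ
  nlinarith [mul_pos (mul_pos hδ0 hδ0) (mul_pos hb₂ (neg_pos.2 ha₂))]

lemma eq_neg_of_projectivelyConvex_of_neg_of_pos {a₁ b₁ a₂ b₂ : ℝ} (ha₁ : a₁ ≤ 0) (hb₁ : 0 ≤ b₁)
    (ha₂ : a₂ < 0) (hb₂ : 0 < b₂) (h : ProjectivelyConvex (sliceLength a₁ b₁ a₂ b₂)) :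
    a₁ = -b₁ := by
  have hl : ProjectivelyConvex (sliceLength (-b₁) (-a₁) a₂ b₂) := by
    simpa only [← sliceLength_neg_left] using h.comp_neg
  have hr : ProjectivelyConvex (sliceLength a₁ b₁ (-b₂) (-a₂)) := by
    simpa only [← sliceLength_neg_right] using h.comp_neg
  have hlr : ProjectivelyConvex (sliceLength (-b₁) (-a₁) (-b₂) (-a₂)) := by
    simpa only [← sliceLength_neg_left] using hr.comp_neg
  have h1 := mul_le_mul_of_projectivelyConvex ha₁ ha₂ hb₂ h
  have h2 := mul_le_mul_of_projectivelyConvex (by linarith) ha₂ hb₂ hl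
  have h3 := mul_le_mul_of_projectivelyConvex ha₁ (by linarith) (by linarith) hr
  have h4 := mul_le_mul_of_projectivelyConvex (by linarith) (by linarith) (by linarith) hlr
  nlinarith

lemma eq_neg_of_projectivelyConvex {a₁ b₁ a₂ b₂ : ℝ} (h₁ : a₁ < b₁) (h₂ : a₂ < b₂)
    (h : ProjectivelyConvex (sliceLength a₁ b₁ a₂ b₂))
    (h' : ProjectivelyConvex (sliceLength a₂ b₂ a₁ b₁)) : a₁ = -b₁ := by
  have hpos := sliceLength_pos_of_projectivelyConvex h₁ h₂ h
  obtain ⟨_, _, _, hI⟩ := exists_ne_zero_of_sliceLength_pos (hpos 0)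
  obtain ⟨_, _, _, hJ⟩ := exists_ne_zero_of_sliceLength_pos
    (sliceLength_pos_of_projectivelyConvex h₂ h₁ h' 0)
  obtain ⟨y, hy0, hyJ, hyI⟩ := exists_ne_zero_of_sliceLength_pos (hpos 1)
  obtain ⟨z, hz0, hzJ, hzI⟩ := exists_ne_zero_of_sliceLength_pos (hpos (-1))
  simp only [neg_zero, zero_mul, Set.mem_Icc, neg_neg, one_mul, neg_mul] at *
  by_cases hJ' : a₂ < 0 ∧ 0 < b₂
  · exact eq_neg_of_projectivelyConvex_of_neg_of_pos hI.1 hI.2 hJ'.1 hJ'.2 h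
  have hI' : a₁ < 0 ∧ 0 < b₁ := by
    rcases lt_or_gt_of_ne hy0 with hy | hy <;> rcases lt_or_gt_of_ne hz0 with hz | hz
    · exact ⟨by linarith, by linarith⟩
    · exact absurd ⟨by linarith, by linarith⟩ hJ'
    · exact absurd ⟨by linarith, by linarith⟩ hJ'
    · exact ⟨by linarith, by linarith⟩
  have := eq_neg_of_projectivelyConvex_of_neg_of_pos hJ.1 hJ.2 hI'.1 hI'.2 h'
  exact absurd ⟨by linarith, by linarith⟩ hJ'

lemma projectivelyConvex_of_convex_ibody {d : ℕ} {s : ℝ} {P : Set (EuclideanSpace ℝ (Fin d))}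
    (hP : Convex ℝ (ibody s P)) {u v : EuclideanSpace ℝ (Fin d)}
    (huv : ∀ t : ℝ, u + t • v ≠ 0) {K : ℝ} (hK : 0 < K) {φ : ℝ → ℝ}
    (hφ : ∀ t, radialFn s P (u + t • v) = K * φ t) : ProjectivelyConvex φ := by
  intro s₀ s₁ α β r h₀ h₁ hαβ hr
  have hmem : ∀ t γ : ℝ, 0 < φ t →
      (γ / |γ|) • (K * φ t) • (u + t • v) ∈ ibody s P := fun t γ ht => by
    have hne : K * φ t ≠ 0 := by positivity
    refine smul_mem_ibody ?_ (Or.inr ⟨smul_ne_zero hne (huv t), ?_⟩)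
    · rw [abs_div, abs_abs]
      exact div_self_le_one _
    · rw [radialFn_smul s P hne, hφ, abs_of_pos (by positivity), div_self hne]
  have habs : ∀ γ : ℝ, |γ| * (γ / |γ|) = γ := fun γ =>
    mul_div_cancel_of_imp' fun h => by simpa using h
  set M := |α| / φ s₀ + |β| / φ s₁ with hM
  have hM0 : 0 < M := by
    have : α ≠ 0 ∨ β ≠ 0 := by
      by_contra! h
      simp [h.1, h.2] at hαβ
    rcases this with h | h
    · have : 0 < |α| := abs_pos.2 h
      positivity
    · have : 0 < |β| := abs_pos.2 h
      positivity
  have hc := hP (hmem s₀ α h₀) (hmem s₁ β h₁) (a := |α| / φ s₀ / M) (b := |β| / φ s₁ / M)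
    (by positivity) (by positivity) (by rw [← add_div, ← hM, div_self hM0.ne'])
  have key : (|α| / φ s₀ / M) • (α / |α|) • (K * φ s₀) • (u + s₀ • v) +
      (|β| / φ s₁ / M) • (β / |β|) • (K * φ s₁) • (u + s₁ • v) =
      (K * (α + β) / M) • (u + r • v) := by
    have e₀ : |α| / φ s₀ / M * (α / |α|) * (K * φ s₀) = K / M * α := by
      conv_rhs => rw [← habs α]
      field_simp
    have e₁ : |β| / φ s₁ / M * (β / |β|) * (K * φ s₁) = K / M * β := by
      conv_rhs => rw [← habs β]
      field_simp
    rw [smul_smul, smul_smul, smul_smul, smul_smul, e₀, e₁]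
    match_scalars
    · ring
    · linear_combination K / M * hr
  rw [key] at hc
  have hne : K * (α + β) / M ≠ 0 := by positivity
  have h1 := (hc.resolve_left (smul_ne_zero hne (huv r))).2
  have hw : 0 < |α + β| := abs_pos.2 hαβ
  rw [radialFn_smul s P hne, hφ, le_div_iff₀ (abs_pos.2 hne), one_mul, abs_div, abs_mul,
    abs_of_pos hK, abs_of_pos hM0, mul_div_assoc, mul_le_mul_iff_right₀ hK, div_le_iff₀ hM0] at h1
  have hφr : 0 < φ r := by
    by_contra! h
    nlinarith
  exact ⟨hφr, by rwa [div_le_iff₀' hφr]⟩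

lemma exists_radialFn_box_eq (n : ℕ) {a b : Fin (n + 1) → ℝ} (hab : ∀ i, a i < b i)
    {i j : Fin (n + 1)} (hij : i ≠ j) :
    ∃ K : ℝ, 0 < K ∧ ∀ s, radialFn n
      {x : EuclideanSpace ℝ (Fin (n + 1)) | ∀ i, x i ∈ Set.Icc (a i) (b i)}
      (EuclideanSpace.single i 1 + s • EuclideanSpace.single j 1) =
      K * sliceLength (a i) (b i) (a j) (b j) s := by
  obtain ⟨c, hc, h⟩ := exists_radialFn_eq_volume n
  refine ⟨c * ∏ l ∈ (Finset.univ.erase i).erase j, (b l - a l),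
    mul_pos hc (Finset.prod_pos fun l _ => sub_pos.2 (hab l)), fun s => ?_⟩
  have hm : MeasurableSet {x : EuclideanSpace ℝ (Fin (n + 1)) | ∀ i, x i ∈ Set.Icc (a i) (b i)} :=
    by
    rw [Set.ofPred_forall]
    exact MeasurableSet.iInter fun l =>
      (by fun_prop : Measurable fun x : EuclideanSpace ℝ (Fin (n + 1)) => x l) measurableSet_Icc
  have hin : ∀ y : EuclideanSpace ℝ (Fin (n + 1)),
      ⟪(EuclideanSpace.single i 1 + s • EuclideanSpace.single j 1 :
        EuclideanSpace ℝ (Fin (n + 1))), y⟫ = y i + s * y j := fun y => by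
    simp [inner_add_left, real_inner_smul_left, EuclideanSpace.inner_single_left]
  rw [h _ hm _ (EuclideanSpace.single i 1) (by simp [hin, hij])]
  let J := Set.Icc (a j) (b j) ∩ {y | -s * y ∈ Set.Icc (a i) (b i)}
  let B : Fin (n + 1) → Set ℝ :=
    Function.update (Function.update (fun l => Set.Icc (a l) (b l)) j J) i (Set.Icc 0 1)
  have hBi : B i = Set.Icc 0 1 := Function.update_self ..
  have hBj : B j = J := by simp [B, hij.symm]
  have hBl : ∀ l, l ≠ i → l ≠ j → B l = Set.Icc (a l) (b l) := fun l h1 h2 => by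
    simp [B, h1, h2]
  have hJ : MeasurableSet J := measurableSet_Icc.inter
    ((by fun_prop : Measurable fun y => -s * y) measurableSet_Icc)
  have hB : MeasurableSet (Set.univ.pi B) := by
    refine MeasurableSet.univ_pi fun l => ?_
    by_cases h1 : l = i
    · rw [h1, hBi]; exact measurableSet_Icc
    by_cases h2 : l = j
    · rw [h2, hBj]; exact hJ
    rw [hBl l h1 h2]; exact measurableSet_Icc
  let t : Matrix.TransvectionStruct (Fin (n + 1)) ℝ := ⟨i, j, hij, s⟩
  have ht : ∀ y l, Matrix.toLin' t.toMatrix y l = y l + if l = i then s * y j else 0 :=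
    fun y l => by
    simp only [t, Matrix.TransvectionStruct.toMatrix_mk, Matrix.transvection, map_add,
      Matrix.toLin'_one, LinearMap.add_apply, LinearMap.id_apply, Pi.add_apply,
      Matrix.toLin'_apply]
    by_cases hl : l = i
    · subst hl; simp [Matrix.single_mulVec]
    · simp [Matrix.single_mulVec, hl]
  have hT := (Real.volume_preserving_transvectionStruct t).comp
    (EuclideanSpace.volume_preserving_symm_measurableEquiv_toLp (Fin (n + 1)))
  have hset : {y : EuclideanSpace ℝ (Fin (n + 1)) |
      ⟪(EuclideanSpace.single i 1 + s • EuclideanSpace.single j 1 :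
        EuclideanSpace ℝ (Fin (n + 1))), y⟫ ∈ Set.Icc 0 1 ∧
      y - ⟪(EuclideanSpace.single i 1 + s • EuclideanSpace.single j 1 :
        EuclideanSpace ℝ (Fin (n + 1))), y⟫ • EuclideanSpace.single i 1 ∈
        {x : EuclideanSpace ℝ (Fin (n + 1)) | ∀ i, x i ∈ Set.Icc (a i) (b i)}} =
      (Matrix.toLin' t.toMatrix ∘ (MeasurableEquiv.toLp 2 (Fin (n + 1) → ℝ)).symm) ⁻¹'
        Set.univ.pi B := by
    ext y
    simp only [hin, Set.mem_preimage, Set.mem_ofPred_eq, Function.comp_apply, Set.mem_univ_pi, ht]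
    have hy : ∀ l, (MeasurableEquiv.toLp 2 (Fin (n + 1) → ℝ)).symm y l = y l := fun l => rfl
    have hsi : y i - (y i + s * y j) = -s * y j := by ring
    simp only [hy, PiLp.sub_apply, PiLp.smul_apply, smul_eq_mul, PiLp.single_apply]
    constructor
    · rintro ⟨h1, h2⟩ l
      by_cases hl : l = i
      · subst hl; rw [hBi, if_pos rfl]; exact h1
      have h3 := h2 l
      rw [if_neg hl, mul_zero, sub_zero] at h3
      rw [if_neg hl, add_zero]
      by_cases hl' : l = j
      · subst hl'
        rw [hBj]
        refine ⟨h3, ?_⟩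
        have h4 := h2 i
        rwa [if_pos rfl, mul_one, hsi] at h4
      · rwa [hBl l hl hl']
    · intro h1
      have hi := h1 i
      have hj := h1 j
      rw [hBi, if_pos rfl] at hi
      rw [hBj, if_neg hij.symm, add_zero] at hj
      refine ⟨hi, fun l => ?_⟩
      by_cases hl : l = i
      · subst hl; rw [if_pos rfl, mul_one, hsi]; exact hj.2
      rw [if_neg hl, mul_zero, sub_zero]
      by_cases hl' : l = j
      · subst hl'; exact hj.1
      have h3 := h1 l
      rwa [hBl l hl hl', if_neg hl, add_zero] at h3
  rw [hset, hT.measure_preimage hB.nullMeasurableSet, volume_pi_pi,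
    ← Finset.mul_prod_erase _ _ (Finset.mem_univ i),
    ← Finset.mul_prod_erase _ _ (Finset.mem_erase.2 ⟨hij.symm, Finset.mem_univ j⟩), hBi, hBj,
    Real.volume_Icc, sub_zero, ENNReal.ofReal_one, one_mul, ENNReal.toReal_mul,
    ENNReal.toReal_prod, mul_assoc, mul_comm (∏ l ∈ _, _)]
  refine congrArg (c * ·) (congrArg (_ * ·) (Finset.prod_congr rfl fun l hl => ?_))
  simp only [Finset.mem_erase] at hl
  rw [hBl l hl.2.1 hl.1, Real.volume_Icc, ENNReal.toReal_ofReal (sub_pos.2 (hab l)).le]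

lemma eq_neg_of_convex_ibody_box (n : ℕ) {a b : Fin (n + 1) → ℝ} (hab : ∀ i, a i < b i)
    (hP : Convex ℝ (ibody n
      {x : EuclideanSpace ℝ (Fin (n + 1)) | ∀ i, x i ∈ Set.Icc (a i) (b i)}))
    {i j : Fin (n + 1)} (hij : i ≠ j) : a i = -b i := by
  have key : ∀ k l : Fin (n + 1), k ≠ l →
      ProjectivelyConvex (sliceLength (a k) (b k) (a l) (b l)) := fun k l hkl => by
    obtain ⟨K, hK, h⟩ := exists_radialFn_box_eq n hab hkl
    refine projectivelyConvex_of_convex_ibody hP (fun t h0 => ?_) hK h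
    have := congrArg (fun y : EuclideanSpace ℝ (Fin (n + 1)) => y k) h0
    simp [hkl] at this
  exact eq_neg_of_projectivelyConvex (hab i) (hab j) (key i j hij) (key j i hij.symm)

/-- Let `d ≥ 2` and `P = [a₁,b₁] × ⋯ × [a_d,b_d] ⊆ ℝ^d` with `aᵢ < bᵢ` be a
`d`-dimensional axis-parallel parallelepiped. Then `IP` is convex iff `P = -P`, i.e. iff
`aᵢ = -bᵢ` for all `i`. -/
theorem statement_1 (d : ℕ) (hd : 2 ≤ d) (a b : Fin d → ℝ) (hab : ∀ i, a i < b i)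
    (P : Set (EuclideanSpace ℝ (Fin d)))
    (hP : P = {x : EuclideanSpace ℝ (Fin d) | ∀ i, x i ∈ Set.Icc (a i) (b i)}) :
    Convex ℝ (ibody ((d : ℝ) - 1) P) ↔ ∀ i, a i = -(b i) := by
  obtain ⟨n, rfl⟩ := Nat.exists_eq_add_of_le' hd
  subst hP
  have hn : (((n + 2 : ℕ) : ℝ) - 1) = ((n + 1 : ℕ) : ℝ) := by push_cast; ring
  rw [hn]
  constructor
  · intro h i
    obtain ⟨j, hj⟩ := exists_ne i
    exact eq_neg_of_convex_ibody_box (n + 1) hab h hj.symm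
  · intro h
    obtain rfl : a = fun i => -(b i) := funext h
    exact convex_ibody_of_symmetric fun i => by linarith [hab i]
end
end

section
/- Let P ⊆ ℝ² be a polygon (a full-dimensional compact convex polytope in ℝ²) with the origin in its interior. If there exists a nonzero u ∈ ℝ² such that the line u^⊥ intersects the boundary ∂P in the relative interiors of two edges of P that are not parallel to each other, then the intersection body IP is not convex. -/
open MeasureTheory
open scoped RealInnerProductSpace

noncomputable section

open Filter Topology

/-- Rotation of the plane by a right angle. -/
def rot (v : EuclideanSpace ℝ (Fin 2)) : EuclideanSpace ℝ (Fin 2) := !₂[-v 1, v 0]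

theorem rot_add (v w : EuclideanSpace ℝ (Fin 2)) : rot (v + w) = rot v + rot w := by
  ext i
  fin_cases i
  · simp [rot]
    ring
  · simp [rot]

theorem rot_smul (t : ℝ) (v : EuclideanSpace ℝ (Fin 2)) : rot (t • v) = t • rot v := by
  ext i
  fin_cases i <;> simp [rot]

theorem norm_rot (v : EuclideanSpace ℝ (Fin 2)) : ‖rot v‖ = ‖v‖ := by
  simp [EuclideanSpace.norm_eq, rot, add_comm]

theorem mem_perp_rot {v : EuclideanSpace ℝ (Fin 2)} (hv : v ≠ 0) (y : EuclideanSpace ℝ (Fin 2)) :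
    y ∈ perp (rot v) ↔ ∃ t : ℝ, y = t • v := by
  have hin : ⟪rot v, y⟫ = v 0 * y 1 - v 1 * y 0 := by
    simp [rot, PiLp.inner_apply, Fin.sum_univ_two]
    ring
  have hpos : v 0 ^ 2 + v 1 ^ 2 ≠ 0 := by
    intro h
    apply hv
    ext i
    fin_cases i <;> simp <;> nlinarith [sq_nonneg (v 0), sq_nonneg (v 1)]
  constructor
  · intro hy
    have hy : v 0 * y 1 - v 1 * y 0 = 0 := hin ▸ hy
    refine ⟨(v 0 * y 0 + v 1 * y 1) / (v 0 ^ 2 + v 1 ^ 2), ?_⟩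
    ext i
    fin_cases i <;> simp <;> field_simp
    · linear_combination -v 1 * hy
    · linear_combination v 0 * hy
  · rintro ⟨t, rfl⟩
    change ⟪rot v, t • v⟫ = 0
    rw [hin]
    simp
    ring

/-- Two vectors orthogonal to a common nonzero vector of the plane are proportional. -/
theorem exists_smul_of_mem_perp {u p q : EuclideanSpace ℝ (Fin 2)} (hu : u ≠ 0) (hp0 : p ≠ 0)
    (hp : p ∈ perp u) (hq : q ∈ perp u) : ∃ t : ℝ, q = t • p := by
  have hr : rot u ≠ 0 := by rwa [← norm_ne_zero_iff, norm_rot, norm_ne_zero_iff]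
  have key : ∀ y ∈ perp u, ∃ t : ℝ, y = t • rot u := by
    intro y hy
    rw [← mem_perp_rot hr]
    have : rot (rot u) = -u := by
      ext i
      fin_cases i <;> simp [rot]
    have hy : ⟪u, y⟫ = 0 := hy
    simp [perp, this, hy]
  obtain ⟨s, rfl⟩ := key p hp
  obtain ⟨t, rfl⟩ := key q hq
  have hs : s ≠ 0 := by
    rintro rfl
    simp at hp0
  exact ⟨t / s, by rw [smul_smul, div_mul_cancel₀ _ hs]⟩

theorem zero_notMem_edge {P : Set (EuclideanSpace ℝ (Fin 2))} {a b : EuclideanSpace ℝ (Fin 2)}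
    (h0 : (0 : EuclideanSpace ℝ (Fin 2)) ∈ interior P) (he : IsEdgeOf P a b) :
    (0 : EuclideanSpace ℝ (Fin 2)) ∉ segment ℝ a b := by
  intro hz
  set z := rot (b - a) with hzdef
  have hz0 : z ≠ 0 := by
    rw [← norm_ne_zero_iff, norm_rot, norm_ne_zero_iff, sub_ne_zero]
    exact he.1.symm
  have hev : ∀ᶠ ε : ℝ in 𝓝 0, ε • z ∈ P := by
    have hc : Tendsto (fun ε : ℝ => ε • z) (𝓝 0) (𝓝 0) := by
      have : Continuous fun ε : ℝ => ε • z := by fun_prop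
      simpa using this.tendsto 0
    exact hc (mem_interior_iff_mem_nhds.1 h0)
  obtain ⟨δ, hδ, hball⟩ := Metric.eventually_nhds_iff.1 hev
  have h1 : (δ / 2) • z ∈ P := hball (by simp [abs_of_pos hδ]; linarith)
  have h2 : (-(δ / 2)) • z ∈ P := hball (by simp [abs_of_pos hδ]; linarith)
  have h3 : (δ / 2) • z ∈ segment ℝ a b := by
    refine he.2.2 h1 h2 hz ⟨1 / 2, 1 / 2, by norm_num, by norm_num, by norm_num, ?_⟩
    module
  rw [segment_eq_image'] at hz h3
  obtain ⟨s, -, hs⟩ := hz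
  obtain ⟨t, -, ht⟩ := h3
  have hzz : (δ / 2) • z = (t - s) • (b - a) := by
    have hs : a + s • (b - a) = 0 := hs
    have ht : a + t • (b - a) = (δ / 2) • z := ht
    rw [← ht, ← sub_zero (a + t • (b - a)), ← hs]
    module
  have horth : ⟪z, b - a⟫ = 0 :=
    (mem_perp_rot (sub_ne_zero.2 he.1.symm) (b - a)).2 ⟨1, by simp⟩
  have := congrArg (fun y => ⟪z, y⟫) hzz
  simp only [inner_smul_right, horth, mul_zero, real_inner_self_eq_norm_sq] at this
  have : 0 < ‖z‖ := norm_pos_iff.2 hz0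
  have : 0 < δ / 2 * ‖z‖ ^ 2 := by positivity
  linarith

theorem smul_notMem_of_mem_edge {P : Set (EuclideanSpace ℝ (Fin 2))}
    {a b A : EuclideanSpace ℝ (Fin 2)} (h0 : (0 : EuclideanSpace ℝ (Fin 2)) ∈ interior P)
    (he : IsEdgeOf P a b) (hA : A ∈ segment ℝ a b) {t : ℝ} (ht : 1 < t) : t • A ∉ P := by
  intro h
  refine zero_notMem_edge h0 he (he.2.2 (interior_subset h0) h hA ?_)
  have ht0 : 0 < t := by linarith
  refine ⟨1 - t⁻¹, t⁻¹, sub_pos.2 (inv_lt_one_of_one_lt₀ ht), by positivity, by ring, ?_⟩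
  rw [smul_zero, zero_add, smul_smul, inv_mul_cancel₀ ht0.ne', one_smul]

/-- The radial function of the intersection body in terms of the points where a line through the
origin leaves `P`, when these lie on edges. -/
theorem radialFn_rot {P : Set (EuclideanSpace ℝ (Fin 2))} (hP : Convex ℝ P)
    (h0 : (0 : EuclideanSpace ℝ (Fin 2)) ∈ interior P) {a₁ b₁ a₂ b₂ A : EuclideanSpace ℝ (Fin 2)}
    (he₁ : IsEdgeOf P a₁ b₁) (he₂ : IsEdgeOf P a₂ b₂) (hA : A ∈ segment ℝ a₁ b₁) {s x : ℝ}
    (hs : 0 < s) (hx : 0 < x) (hB : (-s) • A ∈ segment ℝ a₂ b₂) :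
    radialFn 1 P (rot (x • A)) = (1 + s) / x := by
  have hA0 : A ≠ 0 := by
    rintro rfl
    exact zero_notMem_edge h0 he₁ hA
  have hxA : x • A ≠ 0 := smul_ne_zero hx.ne' hA0
  have hset : P ∩ perp (rot (x • A)) = segment ℝ A ((-s) • A) := by
    ext y
    constructor
    · rintro ⟨hyP, hy⟩
      obtain ⟨t, rfl⟩ := (mem_perp_rot hxA y).1 hy
      rw [smul_smul] at hyP ⊢
      set τ := t * x
      have h1 : τ ≤ 1 := by
        by_contra! h
        exact smul_notMem_of_mem_edge h0 he₁ hA h hyP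
      have h2 : -τ / s ≤ 1 := by
        by_contra! h
        apply smul_notMem_of_mem_edge h0 he₂ hB h
        rw [smul_smul]
        convert hyP using 2
        field_simp
      rw [div_le_one hs] at h2
      refine ⟨(τ + s) / (1 + s), (1 - τ) / (1 + s), div_nonneg (by linarith) (by linarith),
        div_nonneg (by linarith) (by linarith), by field_simp; ring, ?_⟩
      rw [smul_smul, ← add_smul]
      congr 1
      field_simp
      ring
    · intro hy
      refine ⟨hP.segment_subset (he₁.2.1 hA) (he₂.2.1 hB) hy, (mem_perp_rot hxA y).2 ?_⟩
      obtain ⟨α, β, -, -, -, rfl⟩ := hy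
      refine ⟨(α - β * s) / x, ?_⟩
      rw [smul_smul ((α - β * s) / x), div_mul_cancel₀ _ hx.ne']
      module
  have hd : A - (-s) • A = (1 + s) • A := by module
  have hnA : ‖A‖ ≠ 0 := norm_ne_zero_iff.2 hA0
  rw [radialFn, hset, hausdorffMeasure_segment, edist_dist, ENNReal.toReal_ofReal dist_nonneg,
    dist_eq_norm, hd, norm_rot, norm_smul, norm_smul, Real.norm_of_nonneg hx.le,
    Real.norm_of_nonneg (by linarith)]
  field_simp

theorem eventually_mem_segment {p a b : EuclideanSpace ℝ (Fin 2)} (hp : p ∈ openSegment ℝ a b) :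
    ∀ᶠ t : ℝ in 𝓝 0, p + t • (b - a) ∈ segment ℝ a b := by
  rw [openSegment_eq_image'] at hp
  obtain ⟨s, hs, rfl⟩ := hp
  have hc : Tendsto (fun t : ℝ => s + t) (𝓝 0) (𝓝 s) := by
    have : Continuous fun t : ℝ => s + t := by fun_prop
    simpa using this.tendsto 0
  filter_upwards [hc (isOpen_Ioo.mem_nhds hs)] with t ht
  rw [segment_eq_image']
  refine ⟨s + t, Set.Ioo_subset_Icc_self ht, ?_⟩
  simp only
  module

/-- Let `P ⊆ ℝ²` be a polygon with the origin in its interior. If some line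
`u^⊥` through the origin meets the boundary of `P` in the relative interiors of two
non-parallel edges, then `IP` is not convex. -/
theorem statement_4 (P : Set (EuclideanSpace ℝ (Fin 2)))
    (hpoly : IsPolytope P) (h0 : (0 : EuclideanSpace ℝ (Fin 2)) ∈ interior P)
    (u : EuclideanSpace ℝ (Fin 2)) (hu : u ≠ 0)
    (a₁ b₁ a₂ b₂ : EuclideanSpace ℝ (Fin 2))
    (he₁ : IsEdgeOf P a₁ b₁) (he₂ : IsEdgeOf P a₂ b₂)
    (hnonpar : LinearIndependent ℝ ![b₁ - a₁, b₂ - a₂])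
    (hp₁ : ∃ p ∈ openSegment ℝ a₁ b₁, p ∈ perp u)
    (hp₂ : ∃ p ∈ openSegment ℝ a₂ b₂, p ∈ perp u) :
    ¬ Convex ℝ (ibody 1 P) := by
  have hP : Convex ℝ P := by
    obtain ⟨S, rfl⟩ := hpoly
    exact convex_convexHull ℝ _
  obtain ⟨p, hp, hpu⟩ := hp₁
  obtain ⟨p', hp', hpu'⟩ := hp₂
  have hps := openSegment_subset_segment _ _ _ hp
  have hps' := openSegment_subset_segment _ _ _ hp'
  have hp0 : p ≠ 0 := by
    rintro rfl
    exact zero_notMem_edge h0 he₁ hps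
  have hp0' : p' ≠ 0 := by
    rintro rfl
    exact zero_notMem_edge h0 he₂ hps'
  obtain ⟨k, hk⟩ := exists_smul_of_mem_perp hu hp0 hpu hpu'
  have hk0 : k ≠ 0 := by
    rintro rfl
    simp [hk] at hp0'
  have hkneg : k < 0 := by
    by_contra! hk1
    have hkpos : 0 < k := lt_of_le_of_ne hk1 hk0.symm
    rcases lt_trichotomy k 1 with h | h | h
    · apply smul_notMem_of_mem_edge h0 he₂ hps' (one_lt_inv_iff₀.2 ⟨hkpos, h⟩)
      rw [hk, smul_smul, inv_mul_cancel₀ hk0, one_smul]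
      exact he₁.2.1 hps
    · rw [h, one_smul] at hk
      subst hk
      obtain ⟨δ, hδ, hball⟩ := Metric.eventually_nhds_iff.1 (eventually_mem_segment hp')
      have h1 := hball (y := δ / 2) (by simp [abs_of_pos hδ]; linarith)
      have h2 := hball (y := -(δ / 2)) (by simp [abs_of_pos hδ]; linarith)
      have h3 := he₁.2.2 (he₂.2.1 h1) (he₂.2.1 h2) hps
        ⟨1 / 2, 1 / 2, by norm_num, by norm_num, by norm_num, by module⟩
      rw [segment_eq_image'] at h3 hps
      obtain ⟨s, -, hs⟩ := h3
      obtain ⟨t, -, ht⟩ := hps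
      simp only at hs ht
      have hz : (s - t) • (b₁ - a₁) + (-(δ / 2)) • (b₂ - a₂) = 0 := by
        rw [← ht] at hs
        rw [← sub_eq_zero] at hs
        rw [← hs]
        module
      have := (LinearIndependent.pair_iff.1 hnonpar _ _ hz).2
      linarith
    · apply smul_notMem_of_mem_edge h0 he₁ hps h
      rw [← hk]
      exact he₂.2.1 hps'
  obtain ⟨l, m, hlm⟩ : ∃ l m : ℝ, l • (b₁ - a₁) + m • (b₂ - a₂) = p := by
    rw [← Submodule.mem_span_pair]
    have := hnonpar.span_eq_top_of_card_eq_finrank (by simp)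
    rw [Matrix.range_cons, Matrix.range_cons, Matrix.range_empty, Set.union_empty,
      Set.singleton_union] at this
    rw [this]
    trivial
  obtain ⟨c, rfl⟩ : ∃ c, k = -c := ⟨-k, by simp⟩
  have hc : 0 < c := by linarith
  obtain ⟨f, hf⟩ : ∃ f, f = l • (b₁ - a₁) := ⟨_, rfl⟩
  obtain ⟨e, he⟩ : ∃ e, e = m • (b₂ - a₂) := ⟨_, rfl⟩
  rw [← hf, ← he] at hlm
  have hev : ∀ᶠ r : ℝ in 𝓝 1, e + r • f ∈ segment ℝ a₁ b₁ ∧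
      (-(c / r)) • (e + r • f) ∈ segment ℝ a₂ b₂ := by
    have t1 : Tendsto (fun r : ℝ => (r - 1) * l) (𝓝 1) (𝓝 0) := by
      have : ContinuousAt (fun r : ℝ => (r - 1) * l) 1 := by fun_prop
      simpa [ContinuousAt] using this
    have t2 : Tendsto (fun r : ℝ => (c - c / r) * m) (𝓝 1) (𝓝 0) := by
      have : ContinuousAt (fun r : ℝ => (c - c / r) * m) 1 := by fun_prop (disch := norm_num)
      simpa [ContinuousAt] using this
    filter_upwards [t1.eventually (eventually_mem_segment hp),
      t2.eventually (eventually_mem_segment hp'), lt_mem_nhds one_pos] with r h1 h2 hr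
    constructor
    · convert h1 using 1
      rw [← hlm, hf]
      module
    · convert h2 using 1
      have : (-(c / r)) • (e + r • f) = (-(c / r)) • e + (-c) • f := by
        rw [smul_add, smul_smul]
        congr 2
        rw [neg_mul, div_mul_cancel₀ _ hr.ne']
      rw [this, hk, ← hlm, he]
      module
  obtain ⟨δ, hδ, hball⟩ := Metric.eventually_nhds_iff.1 hev
  have hrad : ∀ r x : ℝ, dist r 1 < δ → 0 < r → 0 < x →
      radialFn 1 P (rot (x • (e + r • f))) = (1 + c / r) / x := fun r x hd hr hx =>
    radialFn_rot hP h0 he₁ he₂ (hball hd).1 (by positivity) hx (hball hd).2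
  have hrot0 : ∀ r x : ℝ, dist r 1 < δ → 0 < x → rot (x • (e + r • f)) ≠ 0 := by
    intro r x hd hx
    rw [← norm_ne_zero_iff, norm_rot, norm_ne_zero_iff]
    refine smul_ne_zero hx.ne' fun h => zero_notMem_edge h0 he₁ ?_
    rw [← h]
    exact (hball hd).1
  -- boundary points of the intersection body
  have hmem : ∀ q : ℝ, 0 < q → dist q⁻¹ 1 < δ →
      rot ((1 + c * q) • (e + q⁻¹ • f)) ∈ ibody 1 P := by
    intro q hq hd
    have hx : 0 < 1 + c * q := by positivity
    refine Or.inr ⟨hrot0 _ _ hd hx, ?_⟩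
    rw [hrad _ _ hd (by positivity) hx, div_inv_eq_mul, div_self hx.ne']
  intro hconv
  obtain ⟨η, hη, hηδ⟩ := exists_between hδ
  have hq : 0 < 1 + η := by linarith
  have hinv : (1 + η)⁻¹ = 1 - η / (1 + η) := by
    field_simp
    ring
  have hfrac : η / (1 + η) < η := div_lt_self hη (by linarith)
  have hfrac0 : 0 < η / (1 + η) := by positivity
  have hm1 := hmem (1 + η) hq (by
    rw [hinv, Real.dist_eq, abs_lt]
    constructor <;> linarith)
  have hm2 := hmem (1 + η)⁻¹ (by positivity) (by
    rw [inv_inv, Real.dist_eq, abs_lt]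
    constructor <;> linarith)
  have hmid := hconv hm1 hm2 (a := 1 / 2) (b := 1 / 2) (by norm_num) (by norm_num) (by norm_num)
  obtain ⟨M, hM⟩ : ∃ M, M = ((1 + η) + (1 + η)⁻¹) / 2 := ⟨_, rfl⟩
  have hM1 : 1 < M := by
    rw [hM, hinv]
    linarith
  have hMη : M - 1 < δ := by
    rw [hM, hinv]
    linarith
  have hx : 0 < 1 + c * M := by positivity
  have hcM : 0 < c + M := by positivity
  have heq : (1 / 2 : ℝ) • rot ((1 + c * (1 + η)) • (e + (1 + η)⁻¹ • f)) +
      (1 / 2 : ℝ) • rot ((1 + c * (1 + η)⁻¹) • (e + (1 + η)⁻¹⁻¹ • f)) =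
      rot ((1 + c * M) • (e + ((c + M) / (1 + c * M)) • f)) := by
    rw [← rot_smul, ← rot_smul, ← rot_add]
    congr 1
    rw [smul_add (1 + c * M), smul_smul (1 + c * M), mul_div_cancel₀ _ hx.ne', hM]
    match_scalars
    · ring
    · field_simp
      ring
  have hd : dist ((c + M) / (1 + c * M)) 1 < δ := by
    rw [Real.dist_eq, abs_lt]
    constructor
    · rw [lt_sub_iff_add_lt, lt_div_iff₀ hx]
      nlinarith [mul_pos (mul_pos hδ hc) (sub_pos.2 hM1), mul_pos hc (sub_pos.2 hMη),
        mul_pos hδ hc, mul_pos hc (sub_pos.2 hM1)]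
    · rw [sub_lt_iff_lt_add, div_lt_iff₀ hx]
      nlinarith [mul_pos (mul_pos hδ hc) (sub_pos.2 hM1), mul_pos hδ hc,
        mul_pos hc (sub_pos.2 hM1)]
  rw [heq] at hmid
  rcases hmid with h | ⟨-, h⟩
  · exact hrot0 _ _ hd hx h
  · rw [hrad _ _ hd (by positivity) hx, le_div_iff₀ hx, div_div_eq_mul_div, one_mul,
      add_le_add_iff_left, le_div_iff₀ hcM] at h
    nlinarith [mul_pos hc (sub_pos.2 hM1)]
end
end

section
/- Let P ⊆ ℝ^d be a full-dimensional polytope with vertex set V, and let A(P) be the union of all affine hyperplanes aff(−v₁, …, −v_d) spanned by d affinely independent vertices v₁, …, v_d of P. For t ∈ ℝ^d, define the set of signed cocircuits S(t) := {s : V → {−1, +1} : there exists x ∈ ℝ^d with ⟨x, v + t⟩ ≠ 0 for all v ∈ V and sign⟨x, v + t⟩ = s(v) for all v ∈ V}. Then S(t) = S(t') whenever t and t' lie in the same connected component of ℝ^d \ A(P). -/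
open MeasureTheory
open scoped RealInnerProductSpace

noncomputable section

section SignedCocircuits

open Module

variable {E : Type*} [NormedAddCommGroup E] [InnerProductSpace ℝ E]

/-- A subset of `V` not affinely spanning the whole space lies in a hyperplane that is spanned by
affinely independent points of `V`, as soon as `V` spans the whole space. -/
theorem exists_affineIndependent_affineSpan_le [FiniteDimensional ℝ E] {V F : Set E}
    (hV : V.Finite) (hspan : affineSpan ℝ V = ⊤) (hFV : F ⊆ V) (hF : affineSpan ℝ F ≠ ⊤) :
    ∃ v : Fin (finrank ℝ E) → E, (∀ i, v i ∈ V) ∧ AffineIndependent ℝ v ∧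
      affineSpan ℝ F ≤ affineSpan ℝ (Set.range v) := by
  have hfin : {M | M ⊆ V ∧ affineSpan ℝ M ≠ ⊤}.Finite :=
    hV.finite_subsets.subset fun M hM => hM.1
  obtain ⟨M, hFM, ⟨hMV, hMtop⟩, hMmax⟩ := hfin.exists_le_maximal ⟨hFV, hF⟩
  obtain ⟨w, hwV, hwM⟩ : ∃ w ∈ V, w ∉ affineSpan ℝ M := by
    by_contra! h
    exact hMtop (top_le_iff.1 (hspan ▸ affineSpan_le.2 h))
  obtain ⟨B, hBM, hBspan, hBind⟩ := exists_affineIndependent ℝ E M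
  have hins : affineSpan ℝ (insert w M) = ⊤ := by
    by_contra h
    exact hwM (subset_affineSpan ℝ M
      (hMmax ⟨Set.insert_subset hwV hMV, h⟩ (Set.subset_insert w M) (Set.mem_insert w M)))
  have hins' : affineSpan ℝ (insert w B) = ⊤ := by
    rw [← affineSpan_insert_affineSpan, hBspan, affineSpan_insert_affineSpan, hins]
  have hBfin : B.Finite := hV.subset (hBM.trans hMV)
  have hwB : w ∉ B := fun h => hwM (subset_affineSpan ℝ M (hBM h))
  have hind : AffineIndependent ℝ ((↑) : ↥(insert w B) → E) := by
    refine AffineIndependent.affineIndependent_of_notMem_span (i := ⟨w, Set.mem_insert w B⟩) ?_ ?_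
    · let e : {y : ↥(insert w B) // y ≠ ⟨w, Set.mem_insert w B⟩} ↪ B :=
        ⟨fun y => ⟨y.1.1, y.1.2.resolve_left fun h => y.2 (Subtype.ext h)⟩, fun a b h =>
          Subtype.ext (Subtype.ext (congrArg (fun z : B => (z : E)) h))⟩
      exact hBind.comp_embedding e
    · intro h
      refine hwM (hBspan ▸ affineSpan_mono ℝ ?_ h)
      rintro _ ⟨y, hy, rfl⟩
      exact y.2.resolve_left fun h => hy (Subtype.ext h)
  have : Fintype B := hBfin.fintype
  have : Fintype ↥(insert w B) := (hBfin.insert w).fintype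
  have hcard : Fintype.card B = finrank ℝ E := by
    have h := hind.affineSpan_eq_top_iff_card_eq_finrank_add_one.1 
      (Subtype.range_coe.symm ▸ hins')
    rw [← Nat.card_eq_fintype_card, Nat.card_coe_set_eq,
      Set.ncard_insert_of_notMem hwB hBfin] at h
    rw [← Nat.card_eq_fintype_card, Nat.card_coe_set_eq]
    exact Nat.succ_injective h
  let e := (Fintype.equivFinOfCardEq hcard).symm
  refine ⟨fun i => e i, fun i => hMV (hBM (e i).2), hBind.comp_embedding e.toEmbedding, ?_⟩
  have hrange : Set.range (fun i => (e i : E)) = B := by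
    rw [← Function.comp_def, e.surjective.range_comp, Subtype.range_coe]
  rw [hrange, hBspan]
  exact affineSpan_mono ℝ hFM

theorem affineSpan_ne_top_of_inner_add_eq_zero {F : Set E} {x t : E} (hx : x ≠ 0)
    (hF : ∀ v ∈ F, ⟪x, v + t⟫ = 0) : affineSpan ℝ F ≠ ⊤ := by
  intro h
  have hle : affineSpan ℝ F ≤ AffineSubspace.mk' (-t) (ℝ ∙ x)ᗮ :=
    affineSpan_le.2 fun v hv => by
      simpa [AffineSubspace.mem_mk', Submodule.mem_orthogonal_singleton_iff_inner_right]
        using hF v hv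
  have hmem : x - t ∈ AffineSubspace.mk' (-t) (ℝ ∙ x)ᗮ := hle (h ▸ AffineSubspace.mem_top ℝ E _)
  simp [AffineSubspace.mem_mk', Submodule.mem_orthogonal_singleton_iff_inner_right, hx] at hmem

/-- If `-t` is not in the affine span of `F`, some linear functional takes a prescribed constant
value on `F + t`. -/
theorem exists_inner_add_eq_const [FiniteDimensional ℝ E] {F : Set E} {t : E}
    (ht : -t ∉ affineSpan ℝ F) (c : ℝ) :
    ∃ z : E, ∀ v ∈ F, ⟪z, v + t⟫ = c := by
  rcases F.eq_empty_or_nonempty with rfl | hF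
  · simp
  have : Nonempty (affineSpan ℝ F) := (hF.affineSpan ℝ).to_subtype
  set p : E := ↑(EuclideanGeometry.orthogonalProjection (affineSpan ℝ F) (-t)) with hp
  have hpmem : p ∈ affineSpan ℝ F := EuclideanGeometry.orthogonalProjection_mem _
  have hpt : p + t ≠ 0 := fun h => ht (eq_neg_of_add_eq_zero_left h ▸ hpmem)
  refine ⟨(c / ⟪p + t, p + t⟫) • (p + t), fun v hv => ?_⟩
  have horth : ⟪p + t, v - p⟫ = 0 := by
    have h := EuclideanGeometry.vsub_orthogonalProjection_mem_direction_orthogonal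
      (affineSpan ℝ F) (-t)
    have h' := Submodule.inner_left_of_mem_orthogonal
      (AffineSubspace.vsub_mem_direction (subset_affineSpan ℝ F hv) hpmem) h
    rw [← hp, vsub_eq_sub, vsub_eq_sub, ← neg_add', inner_neg_left, neg_eq_zero, add_comm] at h'
    exact h'
  have hsplit : v + t = (v - p) + (p + t) := by abel
  rw [real_inner_smul_left, hsplit, inner_add_right _ (v - p), horth, zero_add,
    div_mul_cancel₀ _ (inner_self_ne_zero.2 hpt)]

/-- The translations `t` for which the arrangement `{(v + t)ᗮ : v ∈ V}` has an open cell with sign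
vector `s`. -/
def cellTranslations (V : Set E) (s : E → ℝ) : Set E :=
  {t | ∃ x, ∀ v ∈ V, 0 < s v * ⟪x, v + t⟫}

theorem isOpen_cellTranslations {V : Set E} (hV : V.Finite) (s : E → ℝ) :
    IsOpen (cellTranslations V s) := by
  have h : cellTranslations V s = ⋃ x, ⋂ v ∈ V, {t | 0 < s v * ⟪x, v + t⟫} := by
    ext t
    simp [cellTranslations]
  rw [h]
  exact isOpen_iUnion fun x => hV.isOpen_biInter fun v _ =>
    isOpen_lt (by fun_prop) (by fun_prop)

theorem exists_nonneg_of_mem_closure_cellTranslations [FiniteDimensional ℝ E] {V : Set E}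
    (hne : V.Nonempty) {s : E → ℝ} {t : E} (ht : t ∈ closure (cellTranslations V s)) :
    ∃ x : E, x ≠ 0 ∧ ∀ v ∈ V, 0 ≤ s v * ⟪x, v + t⟫ := by
  let C : Set (Metric.sphere (0 : E) 1 × E) := ⋂ v ∈ V, {q | 0 ≤ s v * ⟪(q.1 : E), v + q.2⟫}
  have hC : IsClosed C := isClosed_biInter fun v _ => isClosed_le (by fun_prop) (by fun_prop)
  have hsub : cellTranslations V s ⊆ Prod.snd '' C := by
    rintro u ⟨x, hx⟩
    have hx0 : x ≠ 0 := by
      rintro rfl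
      obtain ⟨v, hv⟩ := hne
      simpa using hx v hv
    refine ⟨(⟨‖x‖⁻¹ • x, by simp [norm_smul, hx0]⟩, u), ?_, rfl⟩
    simp only [C, Set.mem_iInter, Set.mem_ofPred_eq]
    intro v hv
    rw [real_inner_smul_left, mul_left_comm]
    exact mul_nonneg (by positivity) (hx v hv).le
  obtain ⟨⟨x, u⟩, hxu, rfl⟩ := closure_minimal hsub (isClosedMap_snd_of_compactSpace C hC) ht
  refine ⟨x, ne_zero_of_mem_unit_sphere x, ?_⟩
  simpa [C] using hxu

/-- A nonzero weak solution at `t` of a system of sign conditions can be perturbed to a strict one,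
if the system is strictly solvable somewhere and `t` is in general position. -/
theorem mem_cellTranslations_of_nonneg [FiniteDimensional ℝ E] {V : Set E}
    (hV : V.Finite) {s : E → ℝ} (hs : ∀ v ∈ V, s v ≠ 0) (hne : (cellTranslations V s).Nonempty) {t x : E}
    (hx : ∀ v ∈ V, 0 ≤ s v * ⟪x, v + t⟫)
    (ht : -t ∉ affineSpan ℝ {v ∈ V | ⟪x, v + t⟫ = 0}) : t ∈ cellTranslations V s := by
  obtain ⟨t₀, x₀, hx₀⟩ := hne
  obtain ⟨z, hz⟩ := exists_inner_add_eq_const ht ⟪x₀, t₀ - t⟫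
  have hy : ∀ v ∈ V, ⟪x, v + t⟫ = 0 → 0 < s v * ⟪x₀ + z, v + t⟫ := by
    intro v hv h0
    have h : v + t₀ = (v + t) + (t₀ - t) := by abel
    have h' := hx₀ v hv
    rwa [h, inner_add_right, ← hz v ⟨hv, h0⟩, ← inner_add_left] at h'
  have hev : ∀ᶠ ε : ℝ in nhdsWithin 0 (Set.Ioi 0),
      ∀ v ∈ V, 0 < s v * ⟪x + ε • (x₀ + z), v + t⟫ := by
    refine hV.eventually_all.2 fun v hv => ?_
    by_cases h0 : ⟪x, v + t⟫ = 0
    · filter_upwards [self_mem_nhdsWithin] with ε hε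
      rw [inner_add_left, h0, zero_add, real_inner_smul_left, mul_left_comm]
      exact mul_pos hε (hy v hv h0)
    · have hpos : 0 < s v * ⟪x + (0 : ℝ) • (x₀ + z), v + t⟫ := by
        simpa using lt_of_le_of_ne (hx v hv) (mul_ne_zero (hs v hv) h0).symm
      have hcont : Continuous fun ε : ℝ => s v * ⟪x + ε • (x₀ + z), v + t⟫ := by fun_prop
      exact (hcont.continuousAt.eventually (lt_mem_nhds hpos)).filter_mono nhdsWithin_le_nhds
  obtain ⟨ε, hε⟩ := hev.exists
  exact ⟨_, hε⟩

/-- On a connected set of translations avoiding the hyperplanes spanned by affinely independent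
points of `-V`, a sign vector is realized either everywhere or nowhere. -/
theorem IsPreconnected.subset_cellTranslations [FiniteDimensional ℝ E] {V K : Set E} (hV : V.Finite)
    (hspan : affineSpan ℝ V = ⊤) (hK : IsPreconnected K)
    (hgen : ∀ t ∈ K, ∀ v : Fin (finrank ℝ E) → E, (∀ i, v i ∈ V) → AffineIndependent ℝ v →
      -t ∉ affineSpan ℝ (Set.range v))
    {s : E → ℝ} (hs : ∀ v ∈ V, s v ≠ 0) (hne : (K ∩ cellTranslations V s).Nonempty) :
    K ⊆ cellTranslations V s := by
  refine hK.subset_of_closure_inter_subset (isOpen_cellTranslations hV s) hne ?_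
  rintro t ⟨htcl, htK⟩
  have hVne : V.Nonempty := by
    rw [← affineSpan_nonempty ℝ, hspan]
    exact ⟨0, AffineSubspace.mem_top ℝ E 0⟩
  obtain ⟨x, hx0, hx⟩ := exists_nonneg_of_mem_closure_cellTranslations hVne htcl
  refine mem_cellTranslations_of_nonneg hV hs (hne.mono Set.inter_subset_right) hx fun hmem => ?_
  obtain ⟨v, hvV, hvind, hle⟩ := exists_affineIndependent_affineSpan_le hV hspan
    (Set.sep_subset V fun v => ⟪x, v + t⟫ = 0)
    (affineSpan_ne_top_of_inner_add_eq_zero hx0 fun v hv => hv.2)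
  exact hgen t htK v hvV hvind (hle hmem)

end SignedCocircuits

theorem affineSpan_extremePoints_eq_top {E : Type*} [NormedAddCommGroup E] [NormedSpace ℝ E]
    [FiniteDimensional ℝ E] {P : Set E} (hP : IsCompact P) (hconv : Convex ℝ P)
    (hint : (interior P).Nonempty) : affineSpan ℝ (P.extremePoints ℝ) = ⊤ := by
  have hsub : P ⊆ affineSpan ℝ (P.extremePoints ℝ) := by
    conv_lhs => rw [← closure_convexHull_extremePoints hP hconv]
    exact closure_minimal (convexHull_subset_affineSpan _)
      (affineSpan ℝ (P.extremePoints ℝ)).closed_of_finiteDimensional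
  rw [← top_le_iff, ← isOpen_interior.affineSpan_eq_top hint]
  exact affineSpan_le.2 (interior_subset.trans hsub)

theorem mem_affineSpan_range_neg {ι E : Type*} [AddCommGroup E] [Module ℝ E] {v : ι → E} {t : E}
    (h : -t ∈ affineSpan ℝ (Set.range v)) : t ∈ affineSpan ℝ (Set.range fun i => -(v i)) := by
  have hmap := AffineSubspace.mem_map_of_mem (-AffineMap.id ℝ E) h
  rw [AffineSubspace.map_span, ← Set.range_comp] at hmap
  simpa [Function.comp_def] using hmap

/-- Let `P ⊆ ℝ^d` be a full-dimensional polytope with vertex set `V`, and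
`A(P)` the union of the affine hyperplanes `aff(-v₁, …, -v_d)` over all `d`-tuples of affinely
independent vertices. The set of signed cocircuits of the arrangement `{(v+t)^⊥ : v ∈ V}` is
the same for all `t` in a fixed connected component of `ℝ^d \ A(P)`. -/
theorem statement_8 (d : ℕ) (hd : 1 ≤ d) (P : Set (EuclideanSpace ℝ (Fin d)))
    (hpoly : IsPolytope P) (hfull : (interior P).Nonempty)
    (A : Set (EuclideanSpace ℝ (Fin d)))
    (hA : A = {y | ∃ v : Fin d → EuclideanSpace ℝ (Fin d),
      (∀ i, v i ∈ P.extremePoints ℝ) ∧ AffineIndependent ℝ v ∧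
      y ∈ affineSpan ℝ (Set.range fun i => -(v i))})
    (t t' : EuclideanSpace ℝ (Fin d))
    (ht : t ∈ Aᶜ) (ht' : t' ∈ connectedComponentIn Aᶜ t) :
    {s : EuclideanSpace ℝ (Fin d) → ℤ | ∃ x : EuclideanSpace ℝ (Fin d),
        ∀ v ∈ P.extremePoints ℝ,
          (s v = 1 ∧ 0 < ⟪x, v + t⟫) ∨ (s v = -1 ∧ ⟪x, v + t⟫ < 0)}
      = {s : EuclideanSpace ℝ (Fin d) → ℤ | ∃ x : EuclideanSpace ℝ (Fin d),
        ∀ v ∈ P.extremePoints ℝ,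
          (s v = 1 ∧ 0 < ⟪x, v + t'⟫) ∨ (s v = -1 ∧ ⟪x, v + t'⟫ < 0)} := by
  obtain ⟨S, rfl⟩ := hpoly
  set V := (convexHull ℝ (S : Set (EuclideanSpace ℝ (Fin d)))).extremePoints ℝ
  have hV : V.Finite := S.finite_toSet.subset extremePoints_convexHull_subset
  have hspan : affineSpan ℝ V = ⊤ := affineSpan_extremePoints_eq_top
    (S.finite_toSet.isCompact_convexHull ℝ) (convex_convexHull ℝ _) hfull
  set K := connectedComponentIn Aᶜ t
  have hgen : ∀ u ∈ K, ∀ v : Fin (Module.finrank ℝ (EuclideanSpace ℝ (Fin d))) →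
      EuclideanSpace ℝ (Fin d), (∀ i, v i ∈ V) → AffineIndependent ℝ v →
      -u ∉ affineSpan ℝ (Set.range v) := by
    rw [finrank_euclideanSpace_fin]
    intro u hu v hvV hv hmem
    exact connectedComponentIn_subset _ _ hu
      (hA ▸ ⟨v, hvV, hv, mem_affineSpan_range_neg hmem⟩)
  have hmono : ∀ u ∈ K, ∀ u' ∈ K, ∀ s : EuclideanSpace ℝ (Fin d) → ℤ,
      (∃ x : EuclideanSpace ℝ (Fin d), ∀ v ∈ V,
        (s v = 1 ∧ 0 < ⟪x, v + u⟫) ∨ (s v = -1 ∧ ⟪x, v + u⟫ < 0)) →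
      ∃ x : EuclideanSpace ℝ (Fin d), ∀ v ∈ V,
        (s v = 1 ∧ 0 < ⟪x, v + u'⟫) ∨ (s v = -1 ∧ ⟪x, v + u'⟫ < 0) := by
    rintro u hu u' hu' s ⟨x, hx⟩
    have hsign : ∀ v ∈ V, s v = 1 ∨ s v = -1 := fun v hv =>
      (hx v hv).imp And.left And.left
    have hcell : u ∈ cellTranslations V fun v => (s v : ℝ) := by
      refine ⟨x, fun v hv => ?_⟩
      rcases hx v hv with ⟨h, h'⟩ | ⟨h, h'⟩ <;> simpa [h] using h'
    obtain ⟨y, hy⟩ := isPreconnected_connectedComponentIn.subset_cellTranslations hV hspan hgen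
      (fun v hv => by rcases hsign v hv with h | h <;> simp [h]) ⟨u, hu, hcell⟩ hu'
    refine ⟨y, fun v hv => ?_⟩
    have hyv := hy v hv
    rcases hsign v hv with h | h
    · exact Or.inl ⟨h, by simpa [h] using hyv⟩
    · exact Or.inr ⟨h, by simpa [h] using hyv⟩
  have htK : t ∈ K := mem_connectedComponentIn ht
  exact Set.ext fun s => ⟨hmono t htK t' ht' s, hmono t' ht' t htK s⟩
end
end
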